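/- Let K be a quadratic field and let c ∈ K. Suppose there exist a, b ∈ K such that both a and b are of type 2₃ for f_c(z) = z² + c, with f_c^[2](a) = f_c^[2](b) and f_c(a) ≠ f_c(b) (these conditions hold when the graph G(f_c, K) contains a graph of type 14(2,1,1)). Then c = −21/16 and K = ℚ(√17). -/

import Mathlib

open IntermediateField

/-- The quadratic map `f_c(z) = z² + c`. -/
def fc {K : Type*} [Field K] (c : K) : K → K := fun z => z ^ 2 + c

/-- `x` is periodic of exact period `m` for `f_c`. -/
def ExactPeriod {K : Type*} [Field K] (c : K) (m : ℕ) (x : K) : Prop :=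
  (fc c)^[m] x = x ∧ ∀ k : ℕ, 1 ≤ k → k < m → (fc c)^[k] x ≠ x

/-- `x` is periodic for `f_c`. -/
def IsPeriodicPt {K : Type*} [Field K] (c : K) (x : K) : Prop :=
  ∃ m : ℕ, 1 ≤ m ∧ (fc c)^[m] x = x

/-- `x` is of type `m_n` for `f_c`: `f_c^[n] x` is periodic of exact period `m` and
`f_c^[n-1] x` is not periodic. -/
def IsTypeMN {K : Type*} [Field K] (c : K) (m n : ℕ) (x : K) : Prop :=
  ExactPeriod c m ((fc c)^[n] x) ∧ ¬IsPeriodicPt c ((fc c)^[n - 1] x)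

section partABC
open NumberField Module

set_option linter.unusedSectionVars false
section cubic
variable {L : Type*} [Field L] [NumberField L] {τ : L} 

lemma cub_repr (B : Basis (Fin 3) ℚ L) (hB : (B : Fin 3 → L) = ![1, τ, τ^2]) (a b c : ℚ) :
    B.repr ((a:L) + b * τ + c * τ^2) = Finsupp.equivFunOnFinite.symm ![a, b, c] := by
  have : (a:L) + b * τ + c * τ^2 = ∑ i, (![a,b,c] i) • B i := by
    rw [hB]
    simp [Fin.sum_univ_three, Algebra.smul_def]
  rw [this]
  ext i
  rw [B.repr_sum_self]
  simp

lemma cub_mat (hτ : τ^3 = τ^2 + τ + 1) (B : Basis (Fin 3) ℚ L)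
    (hB : (B : Fin 3 → L) = ![1, τ, τ^2]) (a b c : ℚ) :
    Algebra.leftMulMatrix B ((a:L) + b * τ + c * τ^2) =
      !![a, c, b + c; b, a + c, b + 2 * c; c, b + c, a + b + 2 * c] := by
  have h0 : ((a:L) + b * τ + c * τ^2) * 1 = (a:L) + b * τ + c * τ^2 := by ring
  have h1 : ((a:L) + b * τ + c * τ^2) * τ = ((c:ℚ):L) + ((a + c : ℚ):L) * τ + ((b + c : ℚ):L) * τ^2 := by
    push_cast; linear_combination (c:L) * hτ
  have h2 : ((a:L) + b * τ + c * τ^2) * τ^2 = ((b + c:ℚ):L) + ((b + 2 * c : ℚ):L) * τ + ((a + b + 2 * c : ℚ):L) * τ^2 := by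
    push_cast; linear_combination ((c:L) * τ + b + c) * hτ
  ext i j
  rw [Algebra.leftMulMatrix_eq_repr_mul, hB]
  fin_cases j
  · simp only [Fin.zero_eta, Matrix.cons_val_zero]
    rw [h0, cub_repr B hB]; fin_cases i <;> simp
  · simp only [Fin.mk_one, Matrix.cons_val_one, Matrix.cons_val_zero]
    rw [h1, cub_repr B hB]; fin_cases i <;> simp
  · simp only [Fin.reduceFinMk, Matrix.cons_val]
    rw [h2, cub_repr B hB]; fin_cases i <;> simp

lemma cub_norm (hτ : τ^3 = τ^2 + τ + 1) (B : Basis (Fin 3) ℚ L)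
    (hB : (B : Fin 3 → L) = ![1, τ, τ^2]) (a b c : ℚ) :
    Algebra.norm ℚ ((a:L) + b * τ + c * τ^2) =
      a * ((a + c) * (a + b + 2 * c) - (b + 2 * c) * (b + c))
       - c * (b * (a + b + 2 * c) - (b + 2 * c) * c)
       + (b + c) * (b * (b + c) - (a + c) * c) := by
  rw [Algebra.norm_eq_matrix_det B, cub_mat hτ B hB, Matrix.det_fin_three]
  simp
  ring

lemma cub_trace (hτ : τ^3 = τ^2 + τ + 1) (B : Basis (Fin 3) ℚ L)
    (hB : (B : Fin 3 → L) = ![1, τ, τ^2]) (a b c : ℚ) :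
    Algebra.trace ℚ L ((a:L) + b * τ + c * τ^2) = 3 * a + b + 3 * c := by
  rw [Algebra.trace_eq_matrix_trace B, cub_mat hτ B hB, Matrix.trace_fin_three]
  simp
  ring

lemma cub_discr (hτ : τ^3 = τ^2 + τ + 1) (B : Basis (Fin 3) ℚ L)
    (hB : (B : Fin 3 → L) = ![1, τ, τ^2]) : Algebra.discr ℚ (B : Fin 3 → L) = -44 := by
  have t0 : Algebra.trace ℚ L (1 : L) = 3 := by
    have := cub_trace hτ B hB 1 0 0
    norm_num at this ⊢
    exact this
  have t1 : Algebra.trace ℚ L τ = 1 := by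
    have := cub_trace hτ B hB 0 1 0
    norm_num at this; exact this
  have t2 : Algebra.trace ℚ L (τ^2) = 3 := by
    have := cub_trace hτ B hB 0 0 1
    norm_num at this; exact this
  have t3 : Algebra.trace ℚ L (τ * τ^2) = 7 := by
    have := cub_trace hτ B hB 1 1 1
    rw [show τ * τ^2 = ((1:ℚ):L) + ((1:ℚ):L) * τ + ((1:ℚ):L) * τ^2 by push_cast; linear_combination hτ, this]
    norm_num
  have t4 : Algebra.trace ℚ L (τ^2 * τ^2) = 11 := by
    have := cub_trace hτ B hB 1 2 2
    rw [show τ^2 * τ^2 = ((1:ℚ):L) + ((2:ℚ):L) * τ + ((2:ℚ):L) * τ^2 by push_cast; linear_combination (τ+1) * hτ, this]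
    norm_num
  rw [Algebra.discr_def, Matrix.det_fin_three]
  simp only [Algebra.traceMatrix_apply, Algebra.traceForm_apply, hB, Matrix.cons_val_zero, Matrix.cons_val_one, Matrix.cons_val]
  rw [mul_one, mul_one, mul_one, one_mul, one_mul, mul_comm (τ^2) τ, t0, t2, ← pow_two, t1, t2, t3, t4]
  norm_num

lemma cub_fr (B : Basis (Fin 3) ℚ L) : finrank ℚ L = 3 := by
  rw [finrank_eq_card_basis B]; simp

lemma cub_int (hτ : τ^3 = τ^2 + τ + 1) : IsIntegral ℤ τ := by
  refine ⟨Polynomial.X^3 - Polynomial.X^2 - Polynomial.X - 1, ?_, ?_⟩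
  · monicity!
  · simp; linear_combination hτ

lemma cub_Ldiscr (hτ : τ^3 = τ^2 + τ + 1) (B : Basis (Fin 3) ℚ L)
    (hB : (B : Fin 3 → L) = ![1, τ, τ^2]) : ∃ k : ℤ, discr L * k^2 = -44 := by
  have hfr := cub_fr B
  have hcard : Fintype.card (Free.ChooseBasisIndex ℤ (𝓞 L)) = 3 := by
    rw [← finrank_eq_card_chooseBasisIndex, RingOfIntegers.rank, hfr]
  let e := Fintype.equivFinOfCardEq hcard
  let C : Basis (Fin 3) ℤ (𝓞 L) := (RingOfIntegers.basis L).reindex e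
  have hd := discr_eq_discr L C
  let t : 𝓞 L := ⟨τ, cub_int hτ⟩
  let v : Fin 3 → 𝓞 L := ![1, t, t^2]
  have ht : (t : L) = τ := rfl
  have hvc : ∀ i, (v i : L) = B i := by
    intro i
    rw [hB]
    fin_cases i
    · simp [v]
    · simp [v, ht]
    · simp only [v, Fin.reduceFinMk, Matrix.cons_val]
      rw [show ((t^2 : 𝓞 L) : L) = (t : L)^2 from map_pow (algebraMap (𝓞 L) L) _ _, ht]
  have hv : Algebra.discr ℤ v = -44 := by
    have h1 : (algebraMap ℤ ℚ) (Algebra.discr ℤ v) = -44 := by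
      rw [← cub_discr hτ B hB, Algebra.discr_def, Algebra.discr_def, RingHom.map_det]
      congr 1
      ext i j
      simp only [RingHom.mapMatrix_apply, Matrix.map_apply, Algebra.traceMatrix_apply, Algebra.traceForm_apply]
      have := Algebra.coe_trace_int (v i * v j)
      simp only [algebraMap_int_eq, eq_intCast]
      rw [this, show ((v i * v j : 𝓞 L) : L) = (v i : L) * (v j : L) from map_mul (algebraMap (𝓞 L) L) _ _, hvc, hvc]
    have : ((Algebra.discr ℤ v : ℤ) : ℚ) = ((-44:ℤ):ℚ) := by simpa using h1
    exact_mod_cast this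
  refine ⟨(C.toMatrix v).det, ?_⟩
  rw [← hd, ← hv, mul_comm, ← Algebra.discr_of_matrix_vecMul]
  congr 1
  ext i
  congr 1
  rw [Matrix.vecMul, dotProduct]
  conv_rhs => rw [← C.sum_toMatrix_smul_self v i]
  refine Finset.sum_congr rfl fun j _ => ?_
  simp [mul_comm]

lemma cub_discr_cases (hτ : τ^3 = τ^2 + τ + 1) (B : Basis (Fin 3) ℚ L)
    (hB : (B : Fin 3 → L) = ![1, τ, τ^2]) : discr L < 0 ∧ |discr L| ≤ 44 := by
  obtain ⟨k, hk⟩ := cub_Ldiscr hτ B hB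
  have hk0 : 0 < k^2 := by
    have : k ≠ 0 := by rintro rfl; norm_num at hk
    positivity
  have h1 : discr L < 0 := by nlinarith
  refine ⟨h1, ?_⟩
  rw [abs_of_neg h1]; nlinarith

lemma cub_places (hτ : τ^3 = τ^2 + τ + 1) (B : Basis (Fin 3) ℚ L)
    (hB : (B : Fin 3 → L) = ![1, τ, τ^2]) :
    InfinitePlace.nrComplexPlaces L = 1 ∧ Units.rank L = 1 := by
  classical
  have h1 := sign_discr L
  rw [Int.sign_eq_neg_one_of_neg (cub_discr_cases hτ B hB).1] at h1
  have h2 := InfinitePlace.card_add_two_mul_card_eq_rank L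
  rw [cub_fr B] at h2
  have h3 : InfinitePlace.nrComplexPlaces L = 1 := by
    have : InfinitePlace.nrComplexPlaces L ≠ 0 := by
      intro h; rw [h] at h1; norm_num at h1
    omega
  refine ⟨h3, ?_⟩
  rw [Units.rank, InfinitePlace.card_eq_nrRealPlaces_add_nrComplexPlaces]
  omega

lemma cub_pid (hτ : τ^3 = τ^2 + τ + 1) (B : Basis (Fin 3) ℚ L)
    (hB : (B : Fin 3 → L) = ![1, τ, τ^2]) : IsPrincipalIdealRing (𝓞 L) := by
  apply RingOfIntegers.isPrincipalIdealRing_of_abs_discr_lt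
  rw [(cub_places hτ B hB).1, cub_fr B]
  have h := (cub_discr_cases hτ B hB).2
  have h' : ((|discr L| : ℤ) : ℝ) ≤ 44 := by exact_mod_cast h
  refine lt_of_le_of_lt h' ?_
  have hp := Real.pi_gt_d2
  norm_num [Nat.factorial]
  nlinarith

/-- squares in coordinates -/
lemma cub_coord (B : Basis (Fin 3) ℚ L) (hB : (B : Fin 3 → L) = ![1, τ, τ^2]) (z : L) :
    ∃ a b c : ℚ, z = (a:L) + b * τ + c * τ^2 := by
  refine ⟨B.repr z 0, B.repr z 1, B.repr z 2, ?_⟩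
  conv_lhs => rw [← B.sum_repr z]
  rw [hB]; simp [Fin.sum_univ_three, Algebra.smul_def]

lemma cub_inj (B : Basis (Fin 3) ℚ L) (hB : (B : Fin 3 → L) = ![1, τ, τ^2]) {a b c a' b' c' : ℚ}
    (h : (a:L) + b * τ + c * τ^2 = (a':L) + b' * τ + c' * τ^2) : a = a' ∧ b = b' ∧ c = c' := by
  have h' := congrArg B.repr h
  rw [cub_repr B hB, cub_repr B hB] at h'
  have h2 : (![a,b,c] : Fin 3 → ℚ) = ![a',b',c'] := Finsupp.equivFunOnFinite.symm.injective h'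
  exact ⟨congrFun h2 0, congrFun h2 1, congrFun h2 2⟩

lemma cub_sq (hτ : τ^3 = τ^2 + τ + 1) (a b c : ℚ) : ((a:L) + b * τ + c * τ^2)^2 =
    ((a^2 + 2*b*c + c^2 : ℚ) : L) + ((2*a*b + 2*b*c + 2*c^2 : ℚ) : L) * τ
     + ((b^2 + 2*a*c + 2*b*c + 2*c^2 : ℚ) : L) * τ^2 := by
  push_cast
  linear_combination ((c:L)^2 * τ + 2 * b * c + c^2) * hτ

end cubic

/-- scaling rational triples to primitive integer triples (not all even) -/
lemma exists_prim (a b c : ℚ) (h : ¬ (a = 0 ∧ b = 0 ∧ c = 0)) :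
    ∃ (k : ℚ) (x y z : ℤ), k ≠ 0 ∧ a * k = x ∧ b * k = y ∧ c * k = z ∧
      ¬ (2 ∣ x ∧ 2 ∣ y ∧ 2 ∣ z) := by
  obtain ⟨D, hD0, x, y, z, hx, hy, hz⟩ : ∃ D : ℚ, D ≠ 0 ∧ ∃ x y z : ℤ, a * D = x ∧ b * D = y ∧ c * D = z := by
    refine ⟨a.den * b.den * c.den, ?_, a.num * b.den * c.den, b.num * a.den * c.den,
      c.num * a.den * b.den, ?_, ?_, ?_⟩
    · have := a.den_nz; have := b.den_nz; have := c.den_nz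
      positivity
    · push_cast; linear_combination ((b.den:ℚ) * c.den) * Rat.mul_den_eq_num a
    · push_cast; linear_combination ((a.den:ℚ) * c.den) * Rat.mul_den_eq_num b
    · push_cast; linear_combination ((a.den:ℚ) * b.den) * Rat.mul_den_eq_num c
  have key : ∀ n : ℕ, ∀ (D : ℚ) (x y z : ℤ), D ≠ 0 → a * D = x → b * D = y → c * D = z →
      x.natAbs + y.natAbs + z.natAbs ≤ n → ∃ (k : ℚ) (x y z : ℤ), k ≠ 0 ∧ a * k = x ∧ b * k = y ∧ c * k = z ∧
      ¬ (2 ∣ x ∧ 2 ∣ y ∧ 2 ∣ z) := by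
    intro n
    induction n with
    | zero =>
      intro D x y z hD hx hy hz hn
      exfalso
      have h1 : x = 0 := by omega
      have h2 : y = 0 := by omega
      have h3 : z = 0 := by omega
      subst h1 h2 h3
      simp [hD] at hx hy hz
      exact h ⟨hx, hy, hz⟩
    | succ n ih =>
      intro D x y z hD hx hy hz hn
      by_cases hd : 2 ∣ x ∧ 2 ∣ y ∧ 2 ∣ z
      · obtain ⟨⟨x', rfl⟩, ⟨y', rfl⟩, ⟨z', rfl⟩⟩ := hd
        have hnz : ¬ (x' = 0 ∧ y' = 0 ∧ z' = 0) := by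
          rintro ⟨rfl, rfl, rfl⟩
          simp [hD] at hx hy hz
          exact h ⟨hx, hy, hz⟩
        refine ih (D/2) x' y' z' (by positivity) ?_ ?_ ?_ (by omega)
        · push_cast at hx; linear_combination hx / 2
        · push_cast at hy; linear_combination hy / 2
        · push_cast at hz; linear_combination hz / 2
      · exact ⟨D, x, y, z, hD, hx, hy, hz, hd⟩
  exact key _ D x y z hD0 hx hy hz le_rfl

open NumberField Module
set_option linter.unusedSectionVars false
section cubic
variable {L : Type*} [Field L] [NumberField L] {τ : L} 

lemma tau_not_sq (hτ : τ^3 = τ^2 + τ + 1) (B : Basis (Fin 3) ℚ L)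
    (hB : (B : Fin 3 → L) = ![1, τ, τ^2]) (w : L) : τ ≠ w^2 := by
  intro h
  obtain ⟨a, b, c, rfl⟩ := cub_coord B hB w
  rw [cub_sq hτ] at h
  have h' := (show ((0:ℚ):L) + ((1:ℚ):L) * τ + ((0:ℚ):L) * τ^2 = τ by push_cast; ring).trans h
  obtain ⟨h0, h1, h2⟩ := cub_inj B hB h'
  have hne : ¬ (a = 0 ∧ b = 0 ∧ c = 0) := by
    rintro ⟨rfl, rfl, rfl⟩; norm_num at h1
  obtain ⟨k, x, y, z, hk, hx, hy, hz, hp⟩ := exists_prim a b c hne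
  have e0 : x^2 + 2*y*z + z^2 = 0 := by
    have : (x:ℚ)^2 + 2*y*z + z^2 = 0 := by
      rw [← hx, ← hy, ← hz]; linear_combination - k^2 * h0
    exact_mod_cast this
  have e2 : y^2 + 2*x*z + 2*y*z + 2*z^2 = 0 := by
    have : (y:ℚ)^2 + 2*x*z + 2*y*z + 2*z^2 = 0 := by
      rw [← hx, ← hy, ← hz]; linear_combination - k^2 * h2
    exact_mod_cast this
  apply hp
  have hy2 : 2 ∣ y := by
    have : 2 ∣ y^2 := ⟨-(x*z + y*z + z^2), by linarith⟩
    exact Int.prime_two.dvd_of_dvd_pow this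
  obtain ⟨y', rfl⟩ := hy2
  rcases Int.even_or_odd' x with ⟨x', rfl | rfl⟩ <;> rcases Int.even_or_odd' z with ⟨z', rfl | rfl⟩
  · exact ⟨⟨_, rfl⟩, ⟨_, rfl⟩, ⟨_, rfl⟩⟩
  all_goals (ring_nf at e0; omega)

/-- the generator as an algebraic integer -/
def tauO (hτ : τ^3 = τ^2 + τ + 1) : 𝓞 L := ⟨τ, cub_int hτ⟩

lemma tauO_coe (hτ : τ^3 = τ^2 + τ + 1) : ((tauO hτ : 𝓞 L) : L) = τ := rfl

lemma tauO_eq (hτ : τ^3 = τ^2 + τ + 1) : (tauO hτ)^3 = (tauO hτ)^2 + tauO hτ + 1 := by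
  apply RingOfIntegers.ext
  simp only [map_pow, map_add, map_one, tauO_coe]
  exact hτ

lemma units_mod_sq (hτ : τ^3 = τ^2 + τ + 1) (B : Basis (Fin 3) ℚ L)
    (hB : (B : Fin 3 → L) = ![1, τ, τ^2]) (u : (𝓞 L)ˣ) :
    ∃ (s : ℚ) (i : ℕ) (v : L), (s = 1 ∨ s = -1) ∧ i ≤ 1 ∧ ((u : 𝓞 L) : L) = s * τ^i * v^2 := by
  have hr := (cub_places hτ B hB).2
  let i0 : Fin (Units.rank L) := ⟨0, by omega⟩
  have huniq : ∀ i, i = i0 := by intro i; ext; simp only [i0]; omega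
  letI : Unique (Fin (Units.rank L)) := ⟨⟨i0⟩, huniq⟩
  let ε : L := ((Units.fundSystem L i0 : 𝓞 L) : L)
  have hε : ε ≠ 0 := by
    simp [ε]
  have key : ∀ u : (𝓞 L)ˣ, ∃ (s : ℚ) (e : ℤ), (s = 1 ∨ s = -1) ∧ ((u : 𝓞 L) : L) = s * ε^e := by
    intro u
    obtain ⟨⟨ζ, e⟩, h, -⟩ := Units.exist_unique_eq_mul_prod L u
    simp only at h
    rw [Fintype.prod_unique] at h
    have h1 := Units.torsion_eq_one_or_neg_one_of_odd_finrank (K := L) (by rw [cub_fr B]; decide) ζ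
    have hd : (default : Fin (Units.rank L)) = i0 := huniq _
    rw [hd] at h
    rcases h1 with h1 | h1 <;> rw [h1] at h
    · refine ⟨1, e i0, Or.inl rfl, ?_⟩
      rw [h, one_mul]; exact (Units.coe_zpow _ _).trans (by simp [ε])
    · refine ⟨-1, e i0, Or.inr rfl, ?_⟩
      rw [h]; exact (Units.coe_mul _ _).trans (by rw [Units.coe_zpow, Units.coe_neg_one]; simp [ε])
  have hτ0 : τ ≠ 0 := by rintro rfl; norm_num at hτ
  let t : (𝓞 L)ˣ := ⟨tauO hτ, (tauO hτ)^2 - tauO hτ - 1, by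
    linear_combination tauO_eq hτ, by linear_combination tauO_eq hτ⟩
  have ht : ((t : 𝓞 L) : L) = τ := rfl
  obtain ⟨s, e, hs, h1⟩ := key t
  rw [ht] at h1
  obtain ⟨s', e', hs', h2⟩ := key u
  have hNτ : Algebra.norm ℚ τ = 1 := by
    have := cub_norm hτ B hB 0 1 0
    norm_num at this; exact this
  have hodd : Odd e := by
    rw [← Int.not_even_iff_odd]
    rintro ⟨m, rfl⟩
    have h3 : τ = s * (ε^m)^2 := by rw [h1, ← zpow_natCast, ← zpow_mul]; congr 2; push_cast; ring
    rcases hs with rfl | rfl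
    · apply tau_not_sq hτ B hB (ε^m); rw [h3]; push_cast; ring_nf
    · have h4 := congrArg (Algebra.norm ℚ) h3
      rw [hNτ, map_mul, map_pow] at h4
      have h5 : Algebra.norm ℚ (((-1:ℚ)):L) = (-1)^3 := by
        rw [show (((-1:ℚ)):L) = algebraMap ℚ L (-1) by simp, Algebra.norm_algebraMap, cub_fr B]
      rw [h5] at h4
      nlinarith [sq_nonneg (Algebra.norm ℚ (ε^m))]
  obtain ⟨m, rfl⟩ := hodd
  rcases Int.even_or_odd' e' with ⟨m', rfl | rfl⟩
  · refine ⟨s', 0, ε^m', hs', by norm_num, ?_⟩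
    rw [h2, pow_zero, mul_one, ← zpow_natCast, ← zpow_mul]; congr 2; push_cast; ring
  · refine ⟨s' * s, 1, ε^(m'-m), ?_, le_rfl, ?_⟩
    · rcases hs with rfl | rfl <;> rcases hs' with rfl | rfl <;> norm_num
    · rw [h2, pow_one]
      have : (s:L) * s = 1 := by rcases hs with rfl | rfl <;> norm_num
      have e1 : (ε^(m'-m))^2 * ε^(2*m+1) = ε^(2*m'+1) := by
        rw [← zpow_natCast, ← zpow_mul, ← zpow_add₀ hε]; congr 1; push_cast; ring
      push_cast
      calc (s':L) * ε^(2*m'+1) = s' * (s * s) * ((ε^(m'-m))^2 * ε^(2*m+1)) := by rw [this, e1]; ring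
        _ = s' * s * (s * ε^(2*m+1)) * (ε^(m'-m))^2 := by ring
        _ = _ := by rw [← h1]

lemma tauO_norm (hτ : τ^3 = τ^2 + τ + 1) (B : Basis (Fin 3) ℚ L)
    (hB : (B : Fin 3 → L) = ![1, τ, τ^2]) (a b c : ℤ) :
    Algebra.norm ℤ ((a : 𝓞 L) + (b : 𝓞 L) * tauO hτ + (c : 𝓞 L) * (tauO hτ)^2) =
      a * ((a + c) * (a + b + 2 * c) - (b + 2 * c) * (b + c))
       - c * (b * (a + b + 2 * c) - (b + 2 * c) * c)
       + (b + c) * (b * (b + c) - (a + c) * c) := by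
  have h1 := Algebra.coe_norm_int ((a : 𝓞 L) + (b : 𝓞 L) * tauO hτ + (c : 𝓞 L) * (tauO hτ)^2)
  have h2 := cub_norm hτ B hB a b c
  have h3 : (((a : 𝓞 L) + (b : 𝓞 L) * tauO hτ + (c : 𝓞 L) * (tauO hτ)^2 : 𝓞 L) : L)
      = ((a:ℚ):L) + ((b:ℚ):L) * τ + ((c:ℚ):L) * τ^2 := by
    simp only [map_pow, map_add, map_mul, tauO_coe, map_intCast]
    push_cast; rfl
  rw [h3, h2] at h1
  exact_mod_cast h1

lemma dvd_normInt (g : 𝓞 L) : g ∣ ((Algebra.norm ℤ g : ℤ) : 𝓞 L) := by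
  have h := Ideal.absNorm_mem (Ideal.span {g})
  rw [Ideal.absNorm_span_singleton, Ideal.mem_span_singleton] at h
  rcases Int.natAbs_eq (Algebra.norm ℤ g) with h' | h' <;> rw [h']
  · rw [Int.cast_natCast]; exact h
  · rw [Int.cast_neg, Int.cast_natCast]; exact (dvd_neg).2 h

lemma pi_prime (hτ : τ^3 = τ^2 + τ + 1) (B : Basis (Fin 3) ℚ L)
    (hB : (B : Fin 3 → L) = ![1, τ, τ^2]) : Prime (tauO hτ - 1) := by
  have hn : Algebra.norm ℤ (tauO hτ - 1) = 2 := by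
    have := tauO_norm hτ B hB (-1) 1 0
    rw [show tauO hτ - 1 = ((-1:ℤ) : 𝓞 L) + ((1:ℤ) : 𝓞 L) * tauO hτ + ((0:ℤ) : 𝓞 L) * (tauO hτ)^2 by push_cast; ring, this]
    norm_num
  have h0 : tauO hτ - 1 ≠ 0 := by intro h; rw [h] at hn; simp at hn
  rw [← Ideal.span_singleton_prime h0]
  apply Ideal.isPrime_of_irreducible_absNorm
  rw [Ideal.absNorm_span_singleton, hn]
  exact Nat.prime_two

lemma no_eleven (g D k t : ℤ) (hg : g ∣ 352) (hk : k = 1 ∨ k = -1 ∨ k = 2 ∨ k = -2) (ht : t ≠ 0)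
    (s : ℤ) (hs : s = 1 ∨ s = -1) (h : g * (s * D^2) = k * t^2) : g ∣ 32 := by
  by_cases h11 : 11 ∣ g
  · exfalso
    obtain ⟨m, rfl⟩ := h11
    have hm : m ∣ 32 := by
      have : 11 * m ∣ 11 * 32 := by simpa using hg
      exact (mul_dvd_mul_iff_left (by norm_num)).1 this
    have hm11 : ¬ 11 ∣ m := fun h => by
      have := h.trans hm; norm_num at this
    have h2 : 11 * m.natAbs * D.natAbs^2 = k.natAbs * t.natAbs^2 := by
      have := congrArg Int.natAbs h
      simp only [Int.natAbs_mul, Int.natAbs_pow] at this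
      have hs' : s.natAbs = 1 := by rcases hs with rfl | rfl <;> rfl
      rw [hs', one_mul] at this
      simpa using this
    have hD : D ≠ 0 := by
      rintro rfl
      simp at h
      rcases h with rfl | h
      · norm_num at hk
      · exact ht h
    have hm0 : m.natAbs ≠ 0 := by rintro h; apply hm11; rw [Int.natAbs_eq_zero.1 h]; norm_num
    have hf := congrArg (fun n => n.factorization 11) h2
    have hk0 : k.natAbs ≠ 0 := by rcases hk with rfl | rfl | rfl | rfl <;> norm_num
    have p11 : Nat.Prime 11 := by norm_num
    have hmf : m.natAbs.factorization 11 = 0 :=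
      Nat.factorization_eq_zero_of_not_dvd (fun h => hm11 (by
        have := Int.natCast_dvd.2 h; exact_mod_cast this))
    have hkf : k.natAbs.factorization 11 = 0 :=
      Nat.factorization_eq_zero_of_not_dvd (by rcases hk with rfl | rfl | rfl | rfl <;> norm_num)
    beta_reduce at hf
    rw [Nat.factorization_mul (by positivity) (by simpa using hD), Nat.factorization_mul (by norm_num) hm0,
      Nat.factorization_mul hk0 (by simpa using ht), Nat.factorization_pow, Nat.factorization_pow] at hf
    simp [hmf, hkf, p11.factorization_self] at hf
    omega
  · have hc : IsCoprime g 11 := by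
      rw [isCoprime_comm]
      exact (Prime.coprime_iff_not_dvd (by norm_num)).2 h11
    exact hc.dvd_of_dvd_mul_right (by simpa using hg)

lemma cub_key (hτ : τ^3 = τ^2 + τ + 1) (B : Basis (Fin 3) ℚ L)
    (hB : (B : Fin 3 → L) = ![1, τ, τ^2]) (p n k t : ℤ) (hpn : IsCoprime p n)
    (hk : k = 1 ∨ k = -1 ∨ k = 2 ∨ k = -2) (ht : t ≠ 0)
    (h : p^3 - p^2*n - p*n^2 - n^3 = k * t^2) :
    ∃ (s : ℚ) (i j : ℕ) (v : L), (s = 1 ∨ s = -1) ∧ i ≤ 1 ∧ j ≤ 1 ∧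
      (p : L) - n * τ = s * τ^i * 2^j * v^2 := by
  have hpid := cub_pid hτ B hB
  letI : GCDMonoid (𝓞 L) := UniqueFactorizationMonoid.toGCDMonoid _
  set T := tauO hτ with hT
  have hT3 : T^3 = T^2 + T + 1 := tauO_eq hτ
  set α : 𝓞 L := p - n * T with hα
  set G : 𝓞 L := p^2 + p * n * (T - 1) + n^2 * (T^2 - T - 1) with hG
  have hmul : α * (k * G) = ((k * t : ℤ) : 𝓞 L)^2 := by
    have h' : (p : 𝓞 L)^3 - p^2*n - p*n^2 - n^3 = k * t^2 := by exact_mod_cast congrArg (Int.cast : ℤ → 𝓞 L) h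
    push_cast
    rw [hα, hG]
    linear_combination (k : 𝓞 L) * h' - (k : 𝓞 L) * n^3 * hT3
  have hk0 : k ≠ 0 := by rcases hk with rfl | rfl | rfl | rfl <;> norm_num
  have hkt0 : ((k * t : ℤ) : 𝓞 L) ≠ 0 := by
    exact_mod_cast mul_ne_zero hk0 ht
  obtain ⟨α', H, h1, h2, hu⟩ := extract_gcd α ((k : 𝓞 L) * G)
  set g := gcd α ((k : 𝓞 L) * G) with hg
  have hα0 : α ≠ 0 := by intro h0; rw [h0, zero_mul] at hmul; exact hkt0 (pow_eq_zero_iff (two_ne_zero) |>.1 hmul.symm)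
  have hg0 : g ≠ 0 := by intro h0; rw [h0, zero_mul] at h1; exact hα0 h1
  have hdv : g^2 ∣ ((k * t : ℤ) : 𝓞 L)^2 := ⟨α' * H, by rw [← hmul, h1, h2]; ring⟩
  obtain ⟨m, hm⟩ := (IsIntegrallyClosed.pow_dvd_pow_iff (two_ne_zero)).1 hdv
  have hm2 : α' * H = m^2 := by
    apply mul_left_cancel₀ (pow_ne_zero 2 hg0)
    rw [← mul_pow, ← hm, ← hmul, h1, h2]; ring
  obtain ⟨d, w, hw⟩ := exists_associated_pow_of_mul_eq_pow hu hm2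
  -- g divides k * f'(T)
  obtain ⟨x, y, hxy⟩ := hpn
  have hxy' : (x : 𝓞 L) * p + y * n = 1 := by exact_mod_cast congrArg (Int.cast : ℤ → 𝓞 L) hxy
  have hgd : g ∣ k * (3 * T^2 - 2 * T - 1) := by
    have d1 : g ∣ α := ⟨α', h1⟩
    have d2 : g ∣ k * G := ⟨H, h2⟩
    have e1 : (n : 𝓞 L) * (x * T + y) = 1 - x * α := by rw [hα]; linear_combination hxy'
    have e2 : G = n^2 * (3 * T^2 - 2 * T - 1) + α * (p + 2 * n * T - n) := by rw [hG, hα]; ring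
    have e3 : k * (3 * T^2 - 2 * T - 1) = (k * G) * (x * T + y)^2
        + α * (- k * (p + 2 * n * T - n) * (x * T + y)^2 + k * (3 * T^2 - 2 * T - 1) * (2 * x - x^2 * α)) := by
      have e1' : ((n : 𝓞 L) * (x * T + y))^2 = (1 - x * α)^2 := by rw [e1]
      linear_combination (-k * (x * T + y)^2) * e2 - k * (3 * T^2 - 2 * T - 1) * e1'
    rw [e3]
    exact dvd_add (Dvd.dvd.mul_right d2 _) (Dvd.dvd.mul_right d1 _)
  have hn44 : Algebra.norm ℤ (3 * T^2 - 2 * T - 1) = 44 := by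
    have := tauO_norm hτ B hB (-1) (-2) 3
    rw [show 3 * T^2 - 2 * T - 1 = ((-1:ℤ) : 𝓞 L) + ((-2:ℤ) : 𝓞 L) * T + ((3:ℤ) : 𝓞 L) * T^2 by push_cast; ring, this]
    norm_num
  have hfr : finrank ℤ (𝓞 L) = 3 := by rw [RingOfIntegers.rank, cub_fr B]
  have hng : Algebra.norm ℤ g ∣ 352 := by
    have h3 := map_dvd (Algebra.norm ℤ) hgd
    rw [map_mul, hn44, show (k : 𝓞 L) = algebraMap ℤ (𝓞 L) k by simp, Algebra.norm_algebraMap_of_basis ((finBasis ℤ (𝓞 L))), Fintype.card_fin, hfr] at h3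
    refine h3.trans ?_
    rcases hk with rfl | rfl | rfl | rfl <;> norm_num
  have hnα : Algebra.norm ℤ α = k * t^2 := by
    have := tauO_norm hτ B hB p (-n) 0
    rw [hα, show (p : 𝓞 L) - n * T = ((p:ℤ) : 𝓞 L) + ((-n:ℤ) : 𝓞 L) * T + ((0:ℤ) : 𝓞 L) * T^2 by push_cast; ring, this, ← h]
    ring
  have hnw : Algebra.norm ℤ (w : 𝓞 L) = 1 ∨ Algebra.norm ℤ (w : 𝓞 L) = -1 := 
    Int.isUnit_iff.1 (w.isUnit.map (Algebra.norm ℤ))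
  have hN : Algebra.norm ℤ g * (Algebra.norm ℤ (w : 𝓞 L) * (Algebra.norm ℤ d)^2) = k * t^2 := by
    rw [← hnα, h1, ← hw, map_mul, map_mul, map_pow]; ring
  have hg32 := no_eleven _ _ k t hng hk ht _ hnw hN
  have hgpi : g ∣ (T - 1)^15 := by
    have q1 : g ∣ ((32 : ℤ) : 𝓞 L) := (dvd_normInt g).trans (by
      obtain ⟨r, hr⟩ := hg32
      exact ⟨r, by rw [hr]; push_cast; rfl⟩)
    have q2 : (T-1)^3 * T^2 = 2 := by
      linear_combination (T^2 - 2 * T + 2) * hT3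
    have q3 : ((32 : ℤ) : 𝓞 L) = (T-1)^15 * T^10 := by
      rw [show (T-1)^15 * T^10 = ((T-1)^3 * T^2)^5 by ring, q2]; norm_num
    have q4 : IsUnit (T^10) := (IsUnit.of_mul_eq_one (T^2 - T - 1) (by linear_combination hT3)).pow 10
    rw [q3] at q1
    exact (q4.dvd_mul_right).1 q1
  obtain ⟨j, -, hj⟩ := (dvd_prime_pow (pi_prime hτ B hB) 15).1 hgpi
  obtain ⟨w', hw'⟩ := hj.symm
  obtain ⟨s, i, v, hs, hi, hv⟩ := units_mod_sq hτ B hB (w * w')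
  have hτ0 : τ ≠ 0 := by rintro rfl; norm_num at hτ
  have hpi0 : τ - 1 ≠ 0 := by
    intro h0; have : τ = 1 := by linear_combination h0
    rw [this] at hτ; norm_num at hτ
  have hpi : τ - 1 = 2 * (1 / (τ * (τ - 1)))^2 := by
    field_simp
    linear_combination (τ^2 - 2 * τ + 2) * hτ
  have hfin : (p : L) - n * τ = ((w * w' : (𝓞 L)ˣ) : 𝓞 L) * (τ - 1)^j * (d : L)^2 := by
    have : α = ((w * w' : (𝓞 L)ˣ) : 𝓞 L) * (T - 1)^j * d^2 := by
      rw [h1, ← hw, ← hw']; push_cast; ring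
    have h5 := congrArg (algebraMap (𝓞 L) L) this
    simp only [hα, map_sub, map_mul, map_pow, map_one, map_intCast, hT, tauO_coe] at h5
    exact h5
  rw [hfin, hv]
  rcases Nat.even_or_odd' j with ⟨j', rfl | rfl⟩
  · exact ⟨s, i, 0, v * (τ - 1)^j' * d, hs, hi, by norm_num, by ring⟩
  · refine ⟨s, i, 1, v * (τ - 1)^j' * d * (1 / (τ * (τ - 1))), hs, hi, le_rfl, ?_⟩
    rw [pow_succ (τ - 1) (2 * j')]
    nth_rewrite 2 [hpi]
    ring
end cubic


open NumberField Module
section inst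
open Polynomial in
lemma exists_cubic : ∃ (L : Type) (_ : Field L) (_ : NumberField L) (τ : L) (B : Basis (Fin 3) ℚ L),
    τ^3 = τ^2 + τ + 1 ∧ (B : Fin 3 → L) = ![1, τ, τ^2] := by
  let f : ℚ[X] := X^3 - X^2 - X - 1
  have hdeg : f.natDegree = 3 := by simp only [f]; compute_degree!
  have hmon : f.Monic := by simp only [f]; monicity!
  have hf0 : f ≠ 0 := hmon.ne_zero
  have hirr : Irreducible f := by
    apply (irreducible_iff_roots_eq_zero_of_degree_le_three (by omega) (by omega)).2
    rw [Multiset.eq_zero_iff_forall_notMem]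
    intro x hx
    rw [mem_roots hf0] at hx
    have hx' : x^3 - x^2 - x - 1 = 0 := by simpa [f, IsRoot] using hx
    have hint : IsIntegral ℤ x := ⟨X^3 - X^2 - X - 1, by monicity!, by simpa using hx'⟩
    obtain ⟨n, rfl⟩ := IsIntegrallyClosed.isIntegral_iff.1 hint
    simp only [eq_intCast] at hx'
    have h2 : n^3 - n^2 - n - 1 = 0 := by exact_mod_cast hx'
    have h3 : n ∣ 1 := ⟨n^2 - n - 1, by linear_combination -h2⟩
    rcases Int.isUnit_iff.1 (isUnit_of_dvd_one h3) with rfl | rfl <;> norm_num at h2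
  haveI : Fact (Irreducible f) := ⟨hirr⟩
  let pb := AdjoinRoot.powerBasis hf0
  have hdim : pb.dim = 3 := by rw [AdjoinRoot.powerBasis_dim, hdeg]
  haveI : FiniteDimensional ℚ (AdjoinRoot f) := pb.finite
  refine ⟨AdjoinRoot f, inferInstance, { }, AdjoinRoot.root f, pb.basis.reindex (finCongr hdim), ?_, ?_⟩
  · have := AdjoinRoot.eval₂_root f
    simp only [f, eval₂_sub, eval₂_pow, eval₂_X, eval₂_one] at this
    linear_combination this
  · have hg : pb.gen = AdjoinRoot.root f := AdjoinRoot.powerBasis_gen hf0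
    ext i
    rw [Basis.reindex_apply, PowerBasis.basis_eq_pow, hg]
    fin_cases i <;> simp
end inst

section cub_rat

lemma rat_sq_ne_two (x y : ℚ) (hx : x ≠ 0) : y^2 ≠ 2 * x^2 := by
  intro h
  have h2 : (y/x)^2 = 2 := by field_simp; linarith
  have : IsSquare (2:ℚ) := ⟨y/x, by rw [← sq, h2]⟩
  rw [Rat.isSquare_iff] at this
  obtain ⟨⟨r, hr⟩, -⟩ := this
  have hr' : (2:ℤ) = r * r := by simpa using hr
  have h5 : r ≤ 1 := by nlinarith
  have h6 : -1 ≤ r := by nlinarith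
  interval_cases r <;> omega

lemma cubK (p n k t : ℤ) (hpn : IsCoprime p n)
    (hk : k = 1 ∨ k = -1 ∨ k = 2 ∨ k = -2) (ht : t ≠ 0)
    (h : p^3 - p^2*n - p*n^2 - n^3 = k * t^2) :
    ∃ a b c : ℚ, ((p:ℚ) = k * (a^2+2*b*c+c^2) ∧ -(n:ℚ) = k * (2*a*b+2*b*c+2*c^2) ∧ b^2+2*a*c+2*b*c+2*c^2 = 0) ∨
     ((p:ℚ) = k * (b^2+2*a*c+2*b*c+2*c^2) ∧ -(n:ℚ) = k * (a^2+2*b*c+c^2+(b^2+2*a*c+2*b*c+2*c^2)) ∧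
      (2*a*b+2*b*c+2*c^2) + (b^2+2*a*c+2*b*c+2*c^2) = 0) := by
  obtain ⟨L, _, _, τ, B, hτ, hB⟩ := exists_cubic
  obtain ⟨s, i, j, v, hs, hi, hj, hv⟩ := cub_key hτ B hB p n k t hpn hk ht h
  obtain ⟨a, b, c, rfl⟩ := cub_coord B hB v
  set w : L := (a:L) + b * τ + c * τ^2 with hw
  have hN := congrArg (Algebra.norm ℚ) hv
  have hN1 : Algebra.norm ℚ ((p:L) - n * τ) = k * t^2 := by
    have := cub_norm hτ B hB p (-n) 0
    rw [show (p:L) - n * τ = ((p:ℚ):L) + ((-n:ℚ):L) * τ + ((0:ℚ):L) * τ^2 by push_cast; ring, this]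
    have h' : (p:ℚ)^3 - p^2*n - p*n^2 - n^3 = k * t^2 := by exact_mod_cast h
    rw [← h']; ring
  have hNτ : Algebra.norm ℚ τ = 1 := by
    have := cub_norm hτ B hB 0 1 0
    norm_num at this; exact this
  have hNq : ∀ q : ℚ, Algebra.norm ℚ (q:L) = q^3 := by
    intro q
    rw [show (q:L) = algebraMap ℚ L q by simp, Algebra.norm_algebraMap, cub_fr B]
  have hN2 : Algebra.norm ℚ (2:L) = 8 := by
    have := hNq 2; norm_num at this; exact this
  rw [hN1, map_mul, map_mul, map_mul, map_pow, map_pow, map_pow, hNτ, hNq, hN2, one_pow, mul_one] at hN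
  set W := Algebra.norm ℚ w with hW
  have ht2 : (t:ℚ) ≠ 0 := by exact_mod_cast ht
  have htp : (0:ℚ) < t^2 := by positivity
  have hkk : (k:ℚ) = s * 2^j := by
    have n1 := rat_sq_ne_two t (8*W/2) ht2
    have n2 := rat_sq_ne_two t (4*W) ht2
    have hW0 : W = 0 ∨ W ≠ 0 := em _
    have hW0' : W ≠ 0 := by
      intro h0; rw [h0] at hN; simp at hN
      rcases hN with rfl | rfl
      · norm_num at hk
      · exact ht rfl
    have n3 := rat_sq_ne_two W t hW0'
    have hWp : 0 < W^2 := by positivity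
    interval_cases j <;> rcases hs with rfl | rfl <;> rcases hk with rfl | rfl | rfl | rfl <;> norm_num at hN ⊢
    all_goals first
      | nlinarith
      | (exact rat_sq_ne_two t W ht2 (by linarith))
      | (apply n1; linarith)
      | (apply n2; linarith)
      | (apply n3; linarith)
      | (exact rat_sq_ne_two (2*W) t (by simpa using hW0') (by linarith))
  have e : (p:L) - n * τ = ((p:ℚ):L) + ((-n:ℚ):L) * τ + ((0:ℚ):L) * τ^2 := by push_cast; ring
  have hkL : (k:L) = s * 2^j := by exact_mod_cast congrArg (Rat.cast : ℚ → L) hkk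
  refine ⟨a, b, c, ?_⟩
  have hsq := cub_sq hτ a b c
  have hk0 : (k:ℚ) ≠ 0 := by rcases hk with rfl | rfl | rfl | rfl <;> norm_num
  interval_cases i
  · left
    have : (p:L) - n * τ = ((k * (a^2+2*b*c+c^2) : ℚ):L) + ((k*(2*a*b+2*b*c+2*c^2):ℚ):L) * τ + ((k*(b^2+2*a*c+2*b*c+2*c^2):ℚ):L) * τ^2 := by
      rw [hv, hw, hsq]; push_cast; rw [hkL]; ring
    rw [e] at this
    obtain ⟨h0, h1, h2⟩ := cub_inj B hB this
    refine ⟨h0, h1, ?_⟩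
    rcases mul_eq_zero.1 h2.symm with h | h
    · exact absurd h hk0
    · exact h
  · right
    have : (p:L) - n * τ = ((k * (b^2+2*a*c+2*b*c+2*c^2) : ℚ):L) + ((k*(a^2+2*b*c+c^2+(b^2+2*a*c+2*b*c+2*c^2)):ℚ):L) * τ + ((k*((2*a*b+2*b*c+2*c^2) + (b^2+2*a*c+2*b*c+2*c^2)):ℚ):L) * τ^2 := by
      rw [hv, hw, hsq]; push_cast; rw [hkL]
      linear_combination (s:L) * 2^j * ((b:L)^2+2*a*c+2*b*c+2*c^2) * hτ
    rw [e] at this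
    obtain ⟨h0, h1, h2⟩ := cub_inj B hB this
    refine ⟨h0, h1, ?_⟩
    rcases mul_eq_zero.1 h2.symm with h | h
    · exact absurd h hk0
    · exact h
end cub_rat

end partABC

section partDEF
section ell

lemma int_of_rat_sq (z : ℚ) (k : ℤ) (h : z^2 = k) : ∃ w : ℤ, w^2 = k := by
  have : IsSquare (k:ℚ) := ⟨z, by rw [← h, sq]⟩
  rw [Rat.isSquare_intCast_iff] at this
  obtain ⟨r, hr⟩ := this
  exact ⟨r, by rw [hr, sq]⟩

lemma cube_form_bound (m n h a b c d : ℤ) (hm : |m| ≤ h) (hn : |n| ≤ h) :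
    |a*m^3+b*m^2*n+c*m*n^2+d*n^3| ≤ (|a|+|b|+|c|+|d|)*h^3 := by
  have hm0 := abs_nonneg m
  have hn0 := abs_nonneg n
  have h0 : 0 ≤ h := hm0.trans hm
  have e1 : |a*m^3| ≤ |a| *h^3 := by rw [abs_mul, abs_pow]; gcongr
  have e2 : |b*m^2*n| ≤ |b| *h^3 := by
    rw [abs_mul, abs_mul, abs_pow]
    calc |b| * |m|^2 * |n| ≤ |b| * h^2 * h := by gcongr
      _ = _ := by ring
  have e3 : |c*m*n^2| ≤ |c| *h^3 := by
    rw [abs_mul, abs_mul, abs_pow]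
    calc |c| * |m| * |n|^2 ≤ |c| * h * h^2 := by gcongr
      _ = _ := by ring
  have e4 : |d*n^3| ≤ |d| *h^3 := by rw [abs_mul, abs_pow]; gcongr
  have t1 := abs_add_le (a*m^3+b*m^2*n+c*m*n^2) (d*n^3)
  have t2 := abs_add_le (a*m^3+b*m^2*n) (c*m*n^2)
  have t3 := abs_add_le (a*m^3) (b*m^2*n)
  linarith

lemma common_factor (m n P Q N D A B A' B' R : ℤ) (hmn : IsCoprime m n) (hPQ : IsCoprime P Q)
    (hQ : Q ≠ 0) (hR : R ≠ 0) (h : D * P = N * Q) (h1 : A * N + B * D = R * m^7)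
    (h2 : A' * N + B' * D = R * n^7) : ∃ e : ℤ, e ≠ 0 ∧ A * P + B * Q = e * m^7 ∧ A' * P + B' * Q = e * n^7 := by
  have hQD : Q ∣ D := hPQ.symm.dvd_of_dvd_mul_right ⟨N, by rw [h]; ring⟩
  obtain ⟨g, rfl⟩ := hQD
  have hN : N = g * P := by
    apply mul_right_cancel₀ hQ; rw [← h]; ring
  subst hN
  have hg : g ∣ R := by
    obtain ⟨x, y, hxy⟩ := (hmn.pow (m := 7) (n := 7))
    have : R = x * (R * m^7) + y * (R * n^7) := by linear_combination -R * hxy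
    rw [this, ← h1, ← h2]
    exact ⟨x * (A * P + B * Q) + y * (A' * P + B' * Q), by ring⟩
  obtain ⟨e, rfl⟩ := hg
  have hg0 : g ≠ 0 := left_ne_zero_of_mul hR
  refine ⟨e, right_ne_zero_of_mul hR, ?_, ?_⟩
  · apply mul_left_cancel₀ hg0; linear_combination h1
  · apply mul_left_cancel₀ hg0; linear_combination h2

/-- height of a rational -/
def ht (x : ℚ) : ℤ := max |x.num| |(x.den : ℤ)|

lemma ht_pos (x : ℚ) : 0 < ht x := by
  unfold ht
  exact lt_max_of_lt_right (abs_pos.2 (by exact_mod_cast x.den_ne_zero))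

lemma lin_bound (A B P Q H U V : ℤ) (hP : |P| ≤ H) (hQ : |Q| ≤ H) (hA : |A| ≤ U) (hB : |B| ≤ V) :
    |A * P + B * Q| ≤ (U + V) * H := by
  have h1 := abs_add_le (A*P) (B*Q)
  have hU : 0 ≤ U := (abs_nonneg _).trans hA
  have hV : 0 ≤ V := (abs_nonneg _).trans hB
  rw [abs_mul, abs_mul] at h1
  have : |A| *|P| ≤ U * H := by gcongr
  have : |B| *|Q| ≤ V * H := by gcongr
  linarith

lemma ht_desc (x x0 : ℚ) (N D A B A' B' R U V : ℤ) (hR : R ≠ 0)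
    (hx : (D:ℚ) * x = N)
    (h1 : A * N + B * D = R * x0.num^7) (h2 : A' * N + B' * D = R * (x0.den:ℤ)^7)
    (hA : |A| ≤ U * (ht x0)^3) (hB : |B| ≤ V * (ht x0)^3)
    (hA' : |A'| ≤ U * (ht x0)^3) (hB' : |B'| ≤ V * (ht x0)^3) (hle : ht x ≤ ht x0) :
    (ht x0)^3 ≤ U + V := by
  have hd : (x.den : ℚ) ≠ 0 := by exact_mod_cast x.den_ne_zero
  have hx2 : D * x.num = N * (x.den:ℤ) := by
    have : (D:ℚ) * x.num = N * x.den := by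
      rw [← hx, mul_assoc, Rat.mul_den_eq_num]
    exact_mod_cast this
  obtain ⟨e, he, e1, e2⟩ := common_factor x0.num x0.den x.num x.den N D A B A' B' R
    (Rat.isCoprime_num_den x0) (Rat.isCoprime_num_den x) (by exact_mod_cast x.den_ne_zero) hR hx2 h1 h2
  have b1 := lin_bound A B x.num x.den (ht x) _ _ (le_max_left _ _) (le_max_right _ _) hA hB
  have b2 := lin_bound A' B' x.num x.den (ht x) _ _ (le_max_left _ _) (le_max_right _ _) hA' hB'
  rw [e1, abs_mul, abs_pow] at b1
  rw [e2, abs_mul, abs_pow] at b2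
  have he1 : 1 ≤ |e| := Int.one_le_abs he
  have hh := ht_pos x0
  have key : (ht x0)^7 ≤ (U * ht x0^3 + V * ht x0^3) * ht x := by
    rcases max_choice |x0.num| |(x0.den : ℤ)| with h | h
    · have : ht x0 = |x0.num| := h
      refine le_trans ?_ b1
      rw [this]
      have : 0 ≤ |x0.num|^7 := by positivity
      nlinarith
    · have : ht x0 = |(x0.den:ℤ)| := h
      refine le_trans ?_ b2
      rw [this]
      have : 0 ≤ |(x0.den:ℤ)|^7 := by positivity
      nlinarith
  have hUV : 0 ≤ U * ht x0^3 + V * ht x0^3 := add_nonneg ((abs_nonneg _).trans hA) ((abs_nonneg _).trans hB)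
  have k2 : (ht x0)^7 ≤ (U * ht x0^3 + V * ht x0^3) * ht x0 := key.trans (by gcongr)
  have h4 : 0 < ht x0^4 := by positivity
  have : ht x0^4 * (ht x0)^3 ≤ ht x0^4 * (U+V) := by nlinarith
  exact le_of_mul_le_mul_left this h4

lemma small_E1 : ∀ m ∈ Finset.Icc (-9:ℤ) 9, ∀ n ∈ Finset.Icc (1:ℤ) 9, ∀ z ∈ Finset.range 300,
    -2*(m^3-m^2*n-m*n^2-n^3)*n = (z:ℤ)^2 → m = n ∨ m = -n := by
  decide +kernel

lemma small_E2 : ∀ m ∈ Finset.Icc (-10:ℤ) 10, ∀ n ∈ Finset.Icc (1:ℤ) 10, ∀ z ∈ Finset.range 300,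
    (m^3+m^2*n+m*n^2-n^3)*n = (z:ℤ)^2 → False := by
  decide +kernel

lemma not_dvd_helper (n F r : ℤ) (h : IsCoprime n F) (hn : 0 < n) (hz : n * F = r^2) : ∃ s, n = s^2 := by
  obtain ⟨s, hs | hs⟩ := Int.sq_of_isCoprime h hz
  · exact ⟨s, hs⟩
  · nlinarith [sq_nonneg s]

lemma cop_F (p n : ℤ) (h : IsCoprime p n) : IsCoprime n (p^3 - p^2*n - p*n^2 - n^3) := by
  have h3 : IsCoprime n (p^3) := h.symm.pow_right
  rw [show p^3 - p^2*n - p*n^2 - n^3 = p^3 + n * (-p^2 - p*n - n^2) by ring]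
  exact IsCoprime.add_mul_left_right_iff.2 h3

lemma F_ne (p n : ℤ) (h : IsCoprime p n) : p^3 - p^2*n - p*n^2 - n^3 ≠ 0 := by
  intro h0
  have h1 := cop_F p n h
  rw [h0, isCoprime_zero_right] at h1
  have h2 : IsUnit p := by
    refine IsCoprime.isUnit_of_dvd' (h.pow_right (n := 3)) dvd_rfl ⟨p^2 - p*n - n^2, by linear_combination -h0⟩
  rcases Int.isUnit_iff.1 h1 with rfl | rfl <;> rcases Int.isUnit_iff.1 h2 with rfl | rfl <;> norm_num at h0

lemma E1_split (x y : ℚ) (h : y^2 = -2*(x^3-x^2-x-1)) :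
    ∃ s r k : ℤ, r ≠ 0 ∧ s ≠ 0 ∧ x.num^3 - x.num^2*x.den - x.num*(x.den:ℤ)^2 - (x.den:ℤ)^3 = k * r^2 ∧
     ((k = -1 ∧ (x.den:ℤ) = 2*s^2) ∨ (k = -2 ∧ (x.den:ℤ) = s^2)) := by
  have hc := Rat.isCoprime_num_den x
  have hxe : x.num / (x.den:ℚ) = x := Rat.num_div_den x
  have hd : (x.den : ℚ) ≠ 0 := by exact_mod_cast x.den_ne_zero
  have hn : (0:ℤ) < x.den := by exact_mod_cast x.den_pos
  have hx : (x.num:ℚ) = x * x.den := (Rat.mul_den_eq_num x).symm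
  generalize hp : x.num = p at *
  have hx2 : (p:ℚ) = x * ((x.den : ℤ):ℚ) := by rw [hx]; push_cast; rfl
  generalize hnn : (x.den:ℤ) = n at *
  have hF0 := F_ne p n hc
  have hcF := cop_F p n hc
  set F := p^3 - p^2*n - p*n^2 - n^3 with hF
  obtain ⟨z, hz⟩ := int_of_rat_sq (y * n^2) (n * (-2*F)) (by
    rw [hF]; push_cast; rw [hx2, mul_pow, h]; ring)
  rcases Int.even_or_odd' n with ⟨m, hm | hm⟩
  · have hze : 2 ∣ z := by
      apply Int.prime_two.dvd_of_dvd_pow (n := 2); rw [hz, hm]; exact ⟨m * (-2*F), by ring⟩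
    obtain ⟨w, rfl⟩ := hze
    have hw : m * (-F) = w^2 := by rw [hm] at hz; linarith
    have hcm : IsCoprime m (-F) := by
      rw [IsCoprime.neg_right_iff]
      exact IsCoprime.of_isCoprime_of_dvd_left hcF ⟨2, by rw [hm]; ring⟩
    obtain ⟨s, hs⟩ := not_dvd_helper m (-F) w hcm (by linarith) hw
    have hm0 : m ≠ 0 := by rintro rfl; simp at hm; omega
    obtain ⟨r, hr⟩ := not_dvd_helper (-F) m w hcm.symm (by
      rcases lt_trichotomy (-F) 0 with h' | h' | h'
      · nlinarith [sq_nonneg w]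
      · exact absurd (neg_eq_zero.1 h') hF0
      · exact h') (by rw [← hw]; ring)
    refine ⟨s, r, -1, ?_, ?_, by linarith, Or.inl ⟨rfl, by rw [hm, hs]⟩⟩
    · rintro rfl; apply hF0; linarith
    · rintro rfl; apply hm0; rw [hs]; ring
  · have hc2 : IsCoprime n (-2*F) := by
      refine IsCoprime.mul_right ?_ hcF
      rw [IsCoprime.neg_right_iff]
      exact ⟨1, -m, by rw [hm]; ring⟩
    obtain ⟨s, hs⟩ := not_dvd_helper n _ z hc2 hn hz.symm
    obtain ⟨r, hr⟩ := not_dvd_helper (-2*F) n z hc2.symm (by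
      rcases lt_trichotomy (-2*F) 0 with h' | h' | h'
      · nlinarith [sq_nonneg z]
      · exfalso; apply hF0; linarith
      · exact h') (by rw [hz]; ring)
    have hre : 2 ∣ r := by
      apply Int.prime_two.dvd_of_dvd_pow (n := 2); rw [← hr]; exact ⟨-F, by ring⟩
    obtain ⟨w, rfl⟩ := hre
    refine ⟨s, w, -2, ?_, ?_, by linarith, Or.inr ⟨rfl, hs⟩⟩
    · rintro rfl; apply hF0; linarith
    · rintro rfl; rw [hs] at hn; norm_num at hn

lemma E1_no_tau (a b c e : ℚ) (he : e ≠ 0) (h1 : b^2+2*a*b+2*a*c+4*b*c+4*c^2 = 0)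
    (h2 : a^2+b^2+3*c^2+2*a*c+4*b*c = 2*e^2) : False := by
  have hne : ¬ (a = 0 ∧ b = 0 ∧ c = 0) := by
    rintro ⟨rfl, rfl, rfl⟩; apply he; nlinarith
  obtain ⟨k, x, y, z, hk, hx, hy, hz, hp⟩ := exists_prim a b c hne
  have e0 : y^2+2*x*y+2*x*z+4*y*z+4*z^2 = 0 := by
    have : (y:ℚ)^2+2*x*y+2*x*z+4*y*z+4*z^2 = 0 := by
      rw [← hx, ← hy, ← hz]; linear_combination k^2 * h1
    exact_mod_cast this
  obtain ⟨w, hw⟩ := int_of_rat_sq (2*k*e) (2*(x^2+y^2+3*z^2+2*x*z+4*y*z)) (by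
    push_cast; rw [← hx, ← hy, ← hz]; linear_combination -2*k^2 * h2)
  apply hp
  have hw2 : 2 ∣ w := by
    apply Int.prime_two.dvd_of_dvd_pow (n := 2); rw [hw]; exact ⟨_, rfl⟩
  obtain ⟨w, rfl⟩ := hw2
  have hw' : x^2+y^2+3*z^2+2*x*z+4*y*z = 2*w^2 := by linarith
  have hy2 : 2 ∣ y := by
    have : 2 ∣ y^2 := ⟨-(x*y+x*z+2*y*z+2*z^2), by linarith⟩
    exact Int.prime_two.dvd_of_dvd_pow this
  obtain ⟨y', rfl⟩ := hy2
  rcases Int.even_or_odd' x with ⟨x', rfl | rfl⟩ <;> rcases Int.even_or_odd' z with ⟨z', rfl | rfl⟩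
  · exact ⟨⟨_, rfl⟩, ⟨_, rfl⟩, ⟨_, rfl⟩⟩
  · ring_nf at hw'; omega
  · ring_nf at hw'; omega
  · ring_nf at e0; omega

lemma E1_step_aux (a b c x : ℚ) (h2 : b^2+2*a*c+2*b*c+2*c^2 = 0) (h1 : 4*(a*b+b*c+c^2) = 1)
    (hx : x = -2*(a^2+2*b*c+c^2)) :
    ∃ x0 y0 : ℚ, y0^2 = -2*(x0^3-x0^2-x0-1) ∧ 4*(x0^3-x0^2-x0-1)*x = x0^4+2*x0^2+8*x0-3 := by
  have hc : c ≠ 0 := by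
    rintro rfl
    have : b = 0 := by nlinarith
    subst this; norm_num at h1
  have ha : a = -(b^2+2*b*c+2*c^2)/(2*c) := by field_simp; linarith
  have key : -2*((b/c+1)^3-(b/c+1)^2-(b/c+1)-1) = (1/c)^2 := by
    rw [ha] at h1
    field_simp at h1 ⊢
    linear_combination (1/2) * h1
  refine ⟨b/c+1, 1/c, key.symm, ?_⟩
  have k2 : 4*((b/c+1)^3-(b/c+1)^2-(b/c+1)-1) = -2*(1/c)^2 := by linear_combination -2*key
  rw [k2, hx, ha]
  field_simp
  ring

lemma E1_step (x y : ℚ) (h : y^2 = -2*(x^3-x^2-x-1)) :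
    ∃ x0 y0 : ℚ, y0^2 = -2*(x0^3-x0^2-x0-1) ∧ 4*(x0^3-x0^2-x0-1)*x = x0^4+2*x0^2+8*x0-3 := by
  obtain ⟨s, r, k, hr, hs, hF, hk⟩ := E1_split x y h
  have hd : (x.den : ℚ) ≠ 0 := by exact_mod_cast x.den_ne_zero
  have hx : (x.num:ℚ) = x * x.den := (Rat.mul_den_eq_num x).symm
  have hs' : (s:ℚ) ≠ 0 := by exact_mod_cast hs
  obtain ⟨a, b, c, ⟨h0, h1, h2⟩ | ⟨h0, h1, h2⟩⟩ := cubK x.num x.den k r (Rat.isCoprime_num_den x)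
    (by tauto) hr hF
  · rw [hx] at h0
    rcases hk with ⟨rfl, hk⟩ | ⟨rfl, hk⟩
    · have hk' : (x.den:ℚ) = 2*s^2 := by exact_mod_cast hk
      push_cast at h0 h1
      rw [hk'] at h0 h1
      apply E1_step_aux (a/(2*s)) (b/(2*s)) (c/(2*s))
      · field_simp; linarith
      · field_simp; linarith
      · field_simp; linarith
    · have hk' : (x.den:ℚ) = s^2 := by exact_mod_cast hk
      push_cast at h0 h1
      rw [hk'] at h0 h1
      apply E1_step_aux (a/s) (b/s) (c/s)
      · field_simp; linarith
      · field_simp; linarith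
      · field_simp; linarith
  · exfalso
    rcases hk with ⟨rfl, hk⟩ | ⟨rfl, hk⟩
    · have hk' : (x.den:ℚ) = 2*s^2 := by exact_mod_cast hk
      push_cast at h0 h1
      rw [hk'] at h1
      exact E1_no_tau a b c s hs' (by linarith) (by linarith)
    · have hk' : (x.den:ℚ) = s^2 := by exact_mod_cast hk
      push_cast at h0 h1
      rw [hk'] at h1
      exact E1_no_tau a b c (s/2) (by simpa using hs') (by linarith) (by linarith)
end ell

section ell2

lemma ht_small (x : ℚ) (C : ℤ) (h : ht x ≤ C) : x.num ∈ Finset.Icc (-C) C ∧ (x.den:ℤ) ∈ Finset.Icc (1:ℤ) C := by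
  have h1 : |x.num| ≤ C := (le_max_left _ _).trans h
  have h2 : |(x.den:ℤ)| ≤ C := (le_max_right _ _).trans h
  rw [Finset.mem_Icc, Finset.mem_Icc]
  exact ⟨abs_le.1 h1, by exact_mod_cast x.den_pos, (abs_le.1 h2).2⟩

lemma sq_small (z v : ℤ) (h : z^2 = v) (hv : v < 90000) : z.natAbs ∈ Finset.range 300 ∧ v = ((z.natAbs:ℕ):ℤ)^2 := by
  have e : ((z.natAbs:ℕ):ℤ)^2 = v := by rw [← h]; simp
  refine ⟨?_, e.symm⟩
  rw [Finset.mem_range]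
  by_contra! hc
  have : (300:ℤ) ≤ (z.natAbs:ℤ) := by exact_mod_cast hc
  nlinarith

lemma E1_final (x y : ℚ) (h : y^2 = -2*(x^3-x^2-x-1)) : x = 1 ∨ x = -1 := by
  induction hk : (ht x).toNat using Nat.strong_induction_on generalizing x y with
  | _ k ih =>
  obtain ⟨x0, y0, h0, hx⟩ := E1_step x y h
  suffices hx0 : x0 = 1 ∨ x0 = -1 by
    rcases hx0 with rfl | rfl
    · right; linarith
    · left; linarith
  rcases lt_or_ge (ht x0) (ht x) with hlt | hge
  · refine ih (ht x0).toNat ?_ x0 y0 h0 rfl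
    have := ht_pos x0; have := ht_pos x; omega
  · have hd : (x0.den : ℚ) ≠ 0 := by exact_mod_cast x0.den_ne_zero
    have hx0 : (x0.num:ℚ) = x0 * x0.den := (Rat.mul_den_eq_num x0).symm
    have hm : |x0.num| ≤ ht x0 := le_max_left _ _
    have hn : |(x0.den:ℤ)| ≤ ht x0 := le_max_right _ _
    have b := ht_desc x x0
      (x0.num^4+2*x0.num^2*(x0.den:ℤ)^2+8*x0.num*(x0.den:ℤ)^3-3*(x0.den:ℤ)^4)
      (4*(x0.den:ℤ)*(x0.num^3-x0.num^2*x0.den-x0.num*(x0.den:ℤ)^2-(x0.den:ℤ)^3))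
      (176*x0.num^3+(-100)*x0.num^2*x0.den+(-112)*x0.num*(x0.den:ℤ)^2+(-132)*(x0.den:ℤ)^3)
      (25*x0.num^3+(-35)*x0.num^2*x0.den+(-279)*x0.num*(x0.den:ℤ)^2+99*(x0.den:ℤ)^3)
      (0*x0.num^3+12*x0.num^2*x0.den+(-8)*x0.num*(x0.den:ℤ)^2+(-20)*(x0.den:ℤ)^3)
      ((-3)*x0.num^3+(-1)*x0.num^2*x0.den+(-5)*x0.num*(x0.den:ℤ)^2+(-29)*(x0.den:ℤ)^3)
      176 520 438 (by norm_num)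
      (by push_cast; rw [hx0]; linear_combination (x0.den:ℚ)^4 * hx)
      (by ring) (by ring)
      ((cube_form_bound _ _ _ _ _ _ _ hm hn).trans (by norm_num))
      ((cube_form_bound _ _ _ _ _ _ _ hm hn).trans (by norm_num))
      ((cube_form_bound _ _ _ _ _ _ _ hm hn).trans (by
        have : 0 ≤ ht x0^3 := by have := ht_pos x0; positivity
        norm_num; linarith))
      ((cube_form_bound _ _ _ _ _ _ _ hm hn).trans (by
        have : 0 ≤ ht x0^3 := by have := ht_pos x0; positivity
        norm_num; linarith)) hge
    have b9 : ht x0 ≤ 9 := by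
      by_contra! hc
      have : (10:ℤ)^3 ≤ ht x0^3 := by gcongr; omega
      norm_num at b this; omega
    obtain ⟨s1, s2⟩ := ht_small x0 9 b9
    obtain ⟨z, hz⟩ := int_of_rat_sq (y0 * x0.den^2)
      (-2*(x0.num^3-x0.num^2*x0.den-x0.num*(x0.den:ℤ)^2-(x0.den:ℤ)^3)*x0.den) (by
        push_cast; rw [hx0, mul_pow, h0]; ring)
    have s1' := Finset.mem_Icc.1 s1
    have s2' := Finset.mem_Icc.1 s2
    obtain ⟨r1, r2⟩ := sq_small z _ hz (by
      have hF := cube_form_bound x0.num x0.den 9 1 (-1) (-1) (-1) (abs_le.2 s1') (hn.trans b9)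
      norm_num at hF
      have := (abs_le.1 hF).1
      set F := x0.num^3-x0.num^2*x0.den-x0.num*(x0.den:ℤ)^2-(x0.den:ℤ)^3 with hFd
      have hF2 : -2916 ≤ F := by rw [hFd]; linarith
      nlinarith)
    rcases small_E1 x0.num s1 x0.den s2 z.natAbs r1 r2 with h | h
    · left
      rw [← Rat.num_div_den x0, h]; push_cast; field_simp
    · right
      rw [← Rat.num_div_den x0, h]; push_cast; field_simp

lemma E2_no_one (a b c e : ℚ) (he : e ≠ 0) (h1 : b^2+2*a*c+2*b*c+2*c^2 = 0)
    (h2 : a^2+2*b*c+c^2 = -e^2) : False := by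
  have hne : ¬ (a = 0 ∧ b = 0 ∧ c = 0) := by
    rintro ⟨rfl, rfl, rfl⟩; apply he; nlinarith
  obtain ⟨k, x, y, z, hk, hx, hy, hz, hp⟩ := exists_prim a b c hne
  have e0 : y^2+2*x*z+2*y*z+2*z^2 = 0 := by
    have : (y:ℚ)^2+2*x*z+2*y*z+2*z^2 = 0 := by
      rw [← hx, ← hy, ← hz]; linear_combination k^2 * h1
    exact_mod_cast this
  obtain ⟨w, hw⟩ := int_of_rat_sq (k*e) (-(x^2+2*y*z+z^2)) (by
    push_cast; rw [← hx, ← hy, ← hz]; linear_combination k^2 * h2)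
  apply hp
  have hy2 : 2 ∣ y := by
    have : 2 ∣ y^2 := ⟨-(x*z+y*z+z^2), by linarith⟩
    exact Int.prime_two.dvd_of_dvd_pow this
  obtain ⟨y', rfl⟩ := hy2
  rcases Int.even_or_odd' x with ⟨x', rfl | rfl⟩ <;> rcases Int.even_or_odd' z with ⟨z', rfl | rfl⟩ <;>
    rcases Int.even_or_odd' w with ⟨w', rfl | rfl⟩
  · exact ⟨⟨_, rfl⟩, ⟨_, rfl⟩, ⟨_, rfl⟩⟩
  all_goals (ring_nf at hw; omega)

lemma E2_step_aux (a b c x : ℚ) (h1 : b^2+2*a*b+2*a*c+4*b*c+4*c^2 = 0) (h2 : b^2+2*a*c+2*b*c+2*c^2 = -1)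
    (hx : x = a^2+b^2+3*c^2+2*a*c+4*b*c) :
    ∃ x0 y0 : ℚ, y0^2 = x0^3+x0^2+x0-1 ∧ 4*(x0^3+x0^2+x0-1)*x = x0^4-2*x0^2+8*x0+5 := by
  obtain ⟨d, hd⟩ : ∃ d, d = b + c := ⟨_, rfl⟩
  have hb : b = d - c := by rw [hd]; ring
  have hd0 : d ≠ 0 := by
    intro h0
    rw [h0] at hb
    have : b = -c := by rw [hb]; ring
    subst this
    have : c = 0 := by nlinarith
    subst this; norm_num at h2
  have ha : a = -(b^2+4*b*c+4*c^2)/(2*d) := by rw [hd] at hd0 ⊢; field_simp; linarith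
  rw [hb] at ha
  rw [hb, ha] at h2
  have key : (c/d)^3+(c/d)^2+(c/d)-1 = (1/d)^2 := by
    field_simp at h2 ⊢
    linear_combination -h2
  refine ⟨c/d, 1/d, key.symm, ?_⟩
  rw [key, hx, ha, hb]
  field_simp
  ring

lemma E2_step (x y : ℚ) (h : y^2 = x^3+x^2+x-1) :
    ∃ x0 y0 : ℚ, y0^2 = x0^3+x0^2+x0-1 ∧ 4*(x0^3+x0^2+x0-1)*x = x0^4-2*x0^2+8*x0+5 := by
  have hd : (x.den : ℚ) ≠ 0 := by exact_mod_cast x.den_ne_zero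
  have hn : (0:ℤ) < x.den := by exact_mod_cast x.den_pos
  have hx : (x.num:ℚ) = x * x.den := (Rat.mul_den_eq_num x).symm
  have hc := Rat.isCoprime_num_den x
  obtain ⟨z, hz⟩ := int_of_rat_sq (y * x.den^2)
      ((x.den:ℤ)*(x.num^3+x.num^2*x.den+x.num*(x.den:ℤ)^2-(x.den:ℤ)^3)) (by
        push_cast; rw [hx, mul_pow, h]; ring)
  have hF0 := F_ne x.den x.num hc.symm
  set G := x.num^3+x.num^2*x.den+x.num*(x.den:ℤ)^2-(x.den:ℤ)^3 with hG
  have hG0 : G ≠ 0 := by intro h0; apply hF0; rw [hG] at h0; linarith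
  have hcG : IsCoprime (x.den:ℤ) G := by
    have h3 : IsCoprime (x.den:ℤ) (x.num^3) := hc.symm.pow_right
    rw [show G = x.num^3 + x.den * (x.num^2 + x.num*x.den - (x.den:ℤ)^2) by rw [hG]; ring]
    exact IsCoprime.add_mul_left_right_iff.2 h3
  obtain ⟨s, hs⟩ := not_dvd_helper _ _ z hcG hn hz.symm
  obtain ⟨r, hr⟩ := not_dvd_helper G _ z hcG.symm (by
      rcases lt_trichotomy G 0 with h' | h' | h'
      · nlinarith [sq_nonneg z]
      · exact absurd h' hG0
      · exact h') (by rw [hz]; ring)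
  have hs0 : (s:ℚ) ≠ 0 := by
    intro h0; have : s = 0 := by exact_mod_cast h0
    rw [this] at hs; simp at hs
  have hs' : (x.den:ℚ) = s^2 := by exact_mod_cast hs
  have hr0 : r ≠ 0 := by rintro rfl; apply hG0; rw [hr]; ring
  obtain ⟨a, b, c, ⟨h0, h1, h2⟩ | ⟨h0, h1, h2⟩⟩ := cubK x.den x.num (-1) r hc.symm
    (by tauto) hr0 (by rw [hG] at hr; linarith)
  · exfalso
    push_cast at h0 h1
    exact E2_no_one a b c s hs0 h2 (by linarith)
  · push_cast at h0 h1
    rw [hx, hs'] at h1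
    rw [hs'] at h0
    apply E2_step_aux (a/s) (b/s) (c/s)
    · field_simp; linarith
    · field_simp; linarith
    · field_simp; linarith

lemma E2_final (x y : ℚ) (h : y^2 = x^3+x^2+x-1) : False := by
  induction hk : (ht x).toNat using Nat.strong_induction_on generalizing x y with
  | _ k ih =>
  obtain ⟨x0, y0, h0, hx⟩ := E2_step x y h
  rcases lt_or_ge (ht x0) (ht x) with hlt | hge
  · refine ih (ht x0).toNat ?_ x0 y0 h0 rfl
    have := ht_pos x0; have := ht_pos x; omega
  · have hd : (x0.den : ℚ) ≠ 0 := by exact_mod_cast x0.den_ne_zero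
    have hx0 : (x0.num:ℚ) = x0 * x0.den := (Rat.mul_den_eq_num x0).symm
    have hm : |x0.num| ≤ ht x0 := le_max_left _ _
    have hn : |(x0.den:ℤ)| ≤ ht x0 := le_max_right _ _
    have b := ht_desc x x0
      (x0.num^4-2*x0.num^2*(x0.den:ℤ)^2+8*x0.num*(x0.den:ℤ)^3+5*(x0.den:ℤ)^4)
      (4*(x0.den:ℤ)*(x0.num^3+x0.num^2*x0.den+x0.num*(x0.den:ℤ)^2-(x0.den:ℤ)^3))
      (176*x0.num^3+124*x0.num^2*x0.den+168*x0.num*(x0.den:ℤ)^2+(-156)*(x0.den:ℤ)^3)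
      ((-31)*x0.num^3+77*x0.num^2*x0.den+(-297)*x0.num*(x0.den:ℤ)^2+(-195)*(x0.den:ℤ)^3)
      (0*x0.num^3+12*x0.num^2*x0.den+8*x0.num*(x0.den:ℤ)^2+12*(x0.den:ℤ)^3)
      ((-3)*x0.num^3+1*x0.num^2*x0.den+5*x0.num*(x0.den:ℤ)^2+(-29)*(x0.den:ℤ)^3)
      176 624 600 (by norm_num)
      (by push_cast; rw [hx0]; linear_combination (x0.den:ℚ)^4 * hx)
      (by ring) (by ring)
      ((cube_form_bound _ _ _ _ _ _ _ hm hn).trans (by norm_num))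
      ((cube_form_bound _ _ _ _ _ _ _ hm hn).trans (by norm_num))
      ((cube_form_bound _ _ _ _ _ _ _ hm hn).trans (by
        have : 0 ≤ ht x0^3 := by have := ht_pos x0; positivity
        norm_num; linarith))
      ((cube_form_bound _ _ _ _ _ _ _ hm hn).trans (by
        have : 0 ≤ ht x0^3 := by have := ht_pos x0; positivity
        norm_num; linarith)) hge
    have b9 : ht x0 ≤ 10 := by
      by_contra! hc
      have : (11:ℤ)^3 ≤ ht x0^3 := by gcongr; omega
      norm_num at b this; omega
    obtain ⟨s1, s2⟩ := ht_small x0 10 b9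
    obtain ⟨z, hz⟩ := int_of_rat_sq (y0 * x0.den^2)
      ((x0.num^3+x0.num^2*x0.den+x0.num*(x0.den:ℤ)^2-(x0.den:ℤ)^3)*x0.den) (by
        push_cast; rw [hx0, mul_pow, h0]; ring)
    have s1' := Finset.mem_Icc.1 s1
    have s2' := Finset.mem_Icc.1 s2
    obtain ⟨r1, r2⟩ := sq_small z _ hz (by
      have hF := cube_form_bound x0.num x0.den 10 1 1 1 (-1) (abs_le.2 s1') (hn.trans b9)
      norm_num at hF
      have := (abs_le.1 hF).2
      set F := x0.num^3+x0.num^2*x0.den+x0.num*(x0.den:ℤ)^2-(x0.den:ℤ)^3 with hFd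
      have hF2 : F ≤ 4000 := by rw [hFd]; linarith
      nlinarith)
    exact small_E2 x0.num s1 x0.den s2 z.natAbs r1 r2
end ell2

section ratcase

lemma E1f (x y : ℚ) (h : y^2 = 2*(x^3+x^2-x+1)) : x = 1 ∨ x = -1 := by
  rcases E1_final (-x) y (by rw [h]; ring) with h | h
  · right; linarith
  · left; linarith

lemma odd_cop_pow_two (x : ℤ) (h : x % 2 = 1) : IsCoprime x 2 := ⟨1, -(x/2), by omega⟩

lemma g1_sq_false (s w : ℚ) (h0 : s ≠ 0) (h1 : s ≠ -1) (h : w^2 = s^4+4*s^3+2*s^2+1) : False := by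
  have hs : 1 + s ≠ 0 := by intro h; apply h1; linarith
  rcases E1f ((1-s)/(1+s)) (2*w/(1+s)^2) (by
    field_simp; rw [h]; ring) with h | h <;> field_simp at h
  · apply h0; linarith
  · linarith

lemma odd_case (d n z : ℤ) (hn : n % 2 = 1) (hd : d ≠ 0) (hc : IsCoprime n d)
    (h : ((n+4*d)^4+4*(n+4*d)^3*n+2*(n+4*d)^2*n^2+n^4)*((n+4*d)^4+2*(n+4*d)^2*n^2-4*(n+4*d)*n^3+n^4) = z^2) : False := by
  obtain ⟨M, hM⟩ : ∃ M, M = n + 2*d := ⟨_, rfl⟩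
  obtain ⟨C, hC⟩ : ∃ C, C = n^3+8*d*n^2+24*d^2*n+16*d^3 := ⟨_, rfl⟩
  obtain ⟨C2, hC2⟩ : ∃ C2, C2 = n^3+8*d*n^2+16*d^2*n+16*d^3 := ⟨_, rfl⟩
  obtain ⟨e, he⟩ : ∃ e, n = 2*e+1 := ⟨n/2, by omega⟩
  have oM : M % 2 = 1 := by omega
  have hn3 : n^3 % 2 = 1 := by rw [pow_succ, pow_two, Int.mul_emod, Int.mul_emod n n, hn]; rfl
  have oC : C % 2 = 1 := by
    rw [hC, show n^3+8*d*n^2+24*d^2*n+16*d^3 = n^3 + 2*(4*d*n^2+12*d^2*n+8*d^3) by ring]; omega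
  have oC2 : C2 % 2 = 1 := by
    rw [hC2, show n^3+8*d*n^2+16*d^2*n+16*d^3 = n^3 + 2*(4*d*n^2+8*d^2*n+8*d^3) by ring]; omega
  have q1 : (n+4*d)^4+4*(n+4*d)^3*n+2*(n+4*d)^2*n^2+n^4 = 8 * (M * C) := by rw [hM, hC]; ring
  have q2 : (n+4*d)^4+2*(n+4*d)^2*n^2-4*(n+4*d)*n^3+n^4 = 16 * (d * C2) := by rw [hC2]; ring
  have hM0 : M ≠ 0 := by rintro rfl; omega
  have hC0 : C ≠ 0 := by rintro rfl; omega
  have hC20 : C2 ≠ 0 := by rintro rfl; omega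
  have hn0 : n ≠ 0 := by rintro rfl; omega
  -- positivity
  have hpos : 0 < M * C := by
    have hz : 0 < (8 * (M * C)) * (16 * (d * C2)) := by
      rw [← q1, ← q2, h]
      have : z ≠ 0 := by
        rintro rfl
        rw [q1, q2] at h
        have : (8 * (M * C)) * (16 * (d * C2)) ≠ 0 := by positivity
        exact this (by rw [h]; ring)
      positivity
    rcases lt_trichotomy ((n+4*d)*n) 0 with hs | hs | hs
    · have : 0 < 16 * (d * C2) := by
        rw [← q2]
        have : 0 < n^2 := by positivity
        nlinarith [sq_nonneg ((n+4*d)^2 + n^2), mul_pos (neg_pos.2 hs) this]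
      have := (mul_pos_iff_of_pos_right this).1 hz
      linarith
    · have : 0 < 8 * (M * C) := by
        rw [← q1]
        have e1 : (n+4*d)^4+4*(n+4*d)^3*n+2*(n+4*d)^2*n^2+n^4 = (n+4*d)^4 + (4*(n+4*d)^2+2*((n+4*d)*n))*((n+4*d)*n) + n^4 := by ring
        rw [e1, hs]; positivity
      linarith
    · have : 0 < 8 * (M * C) := by
        rw [← q1]
        have e1 : (n+4*d)^4+4*(n+4*d)^3*n+2*(n+4*d)^2*n^2+n^4 = (n+4*d)^4 + (4*(n+4*d)^2+2*((n+4*d)*n))*((n+4*d)*n) + n^4 := by ring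
        rw [e1]; positivity
      linarith
  rw [q1, q2] at h
  obtain ⟨w, hw⟩ := int_of_rat_sq ((z:ℚ)/8) (2*M*C*d*C2) (by
    have h' : (8 * ((M:ℚ) * C)) * (16 * (d * C2)) = z^2 := by exact_mod_cast h
    push_cast; rw [div_pow, ← h']; ring)
  -- coprimality
  have cM2 := odd_cop_pow_two M oM
  have cC_2 := odd_cop_pow_two C oC
  have cC2_2 := odd_cop_pow_two C2 oC2
  have cMd : IsCoprime M d := by
    rw [hM]; exact IsCoprime.add_mul_right_left_iff.2 hc
  have cCd : IsCoprime C d := by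
    rw [hC, show n^3+8*d*n^2+24*d^2*n+16*d^3 = n^3 + (8*n^2+24*d*n+16*d^2)*d by ring]
    exact IsCoprime.add_mul_right_left_iff.2 (hc.pow_left)
  have cC2d : IsCoprime C2 d := by
    rw [hC2, show n^3+8*d*n^2+16*d^2*n+16*d^3 = n^3 + (8*n^2+16*d*n+16*d^2)*d by ring]
    exact IsCoprime.add_mul_right_left_iff.2 (hc.pow_left)
  have c2n : IsCoprime n 2 := odd_cop_pow_two n hn
  have cM8 : IsCoprime M (2^3*d^3) := (cM2.pow_right).mul_right (cMd.pow_right)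
  have cMC2 : IsCoprime C2 M := by
    rw [hC2, show n^3+8*d*n^2+16*d^2*n+16*d^3 = 2^3*d^3 + (n^2+6*d*n+4*d^2)*M by rw [hM]; ring]
    exact IsCoprime.add_mul_right_left_iff.2 cM8.symm
  have cMC : IsCoprime C M := by
    rw [hC, show n^3+8*d*n^2+24*d^2*n+16*d^3 = -(2^3*d^3) + (n^2+6*d*n+12*d^2)*M by rw [hM]; ring]
    exact IsCoprime.add_mul_right_left_iff.2 cM8.symm.neg_left
  have cCn : IsCoprime C n := by
    rw [hC, show n^3+8*d*n^2+24*d^2*n+16*d^3 = 2^4*d^3 + (n^2+8*d*n+24*d^2)*n by ring]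
    exact IsCoprime.add_mul_right_left_iff.2 ((c2n.symm.pow_left).mul_left hc.symm.pow_left)
  have cCC2 : IsCoprime C C2 := by
    rw [show C2 = -(2^3*d^2*n) + C by rw [hC, hC2]; ring]
    have : IsCoprime C (2^3*d^2*n) := ((cC_2.pow_right).mul_right cCd.pow_right).mul_right cCn
    simpa using (IsCoprime.add_mul_left_right_iff (z := 1)).2 this.neg_right
  obtain ⟨r1, hr1⟩ := Int.sq_of_isCoprime (a := C) (b := 2*M*d*C2) (c := w)
    (((cC_2.mul_right cMC).mul_right cCd).mul_right cCC2) (by rw [hw]; ring)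
  obtain ⟨r2, hr2⟩ := Int.sq_of_isCoprime (a := C2) (b := 2*M*d*C) (c := w)
    (((cC2_2.mul_right cMC2).mul_right cC2d).mul_right cCC2.symm) (by rw [hw]; ring)
  obtain ⟨r3, hr3⟩ := Int.sq_of_isCoprime (a := M) (b := 2*C*d*C2) (c := w)
    (((cM2.mul_right cMC.symm).mul_right cMd).mul_right cMC2.symm) (by rw [hw]; ring)
  have hmod : C % 8 = C2 % 8 := by
    have : C = C2 + 8*(d^2*n) := by rw [hC, hC2]; ring
    omega
  have hsq8 : ∀ r : ℤ, r^2 % 2 = 1 → r^2 % 8 = 1 := by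
    intro r hr
    rcases Int.even_or_odd' r with ⟨k, rfl | rfl⟩
    · ring_nf at hr; omega
    · obtain ⟨j, hj⟩ := Int.even_mul_succ_self k
      rw [show (2*k+1)^2 = 4*(k*(k+1))+1 by ring, hj]; omega
  have hfin : ∃ ε : ℤ, ε^2 = 1 ∧ M = ε * r3^2 ∧ C2 = ε * r2^2 := by
    have r1p := sq_nonneg r1
    have r3p := sq_nonneg r3
    rcases hr1 with hr1 | hr1 <;> rcases hr2 with hr2 | hr2 <;> rcases hr3 with hr3 | hr3
    · exact ⟨1, by norm_num, by linarith, by linarith⟩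
    · exfalso; rw [hr1, hr3] at hpos; nlinarith
    · exfalso
      have a1 := hsq8 r1 (by omega)
      have a2 := hsq8 r2 (by omega)
      omega
    · exfalso
      have a1 := hsq8 r1 (by omega)
      have a2 := hsq8 r2 (by omega)
      omega
    · exfalso
      have a1 := hsq8 r1 (by omega)
      have a2 := hsq8 r2 (by omega)
      omega
    · exfalso
      have a1 := hsq8 r1 (by omega)
      have a2 := hsq8 r2 (by omega)
      omega
    · exfalso; rw [hr1, hr3] at hpos; nlinarith
    · exact ⟨-1, by norm_num, by linarith, by linarith⟩
  obtain ⟨ε, hε, hM3, hC23⟩ := hfin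
  have hr30 : (r3:ℚ) ≠ 0 := by
    intro h0; apply hM0; rw [hM3, show r3 = 0 by exact_mod_cast h0]; ring
  have hr20 : (r2:ℚ) ≠ 0 := by
    intro h0; apply hC20; rw [hC23, show r2 = 0 by exact_mod_cast h0]; ring
  have hd' : (d:ℚ) ≠ 0 := by exact_mod_cast hd
  have hw2 : (w:ℚ)^2 = 2*C*d*(r2*r3)^2 := by
    have : w^2 = 2*C*d*(r2*r3)^2 := by
      rw [hw, hM3, hC23]; linear_combination 2*C*d*(r2*r3)^2 * hε
    exact_mod_cast this
  apply E2_final ((M:ℚ)/(2*d)) (w/(4*d^2*r2*r3))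
  rw [div_pow, hw2, hC, hM]; push_cast
  field_simp
  ring

lemma rat_prod (s w : ℚ) (h0 : s ≠ 0) (h1 : s ≠ 1) (h2 : s ≠ -1)
    (h : (s^4+4*s^3+2*s^2+1)*(s^4+2*s^2-4*s+1) = w^2) : False := by
  have hc := Rat.isCoprime_num_den s
  have hx : (s.num:ℚ) = s * s.den := (Rat.mul_den_eq_num s).symm
  have hd : (s.den : ℚ) ≠ 0 := by exact_mod_cast s.den_ne_zero
  obtain ⟨n, hn⟩ : ∃ n : ℤ, n = s.den := ⟨_, rfl⟩
  obtain ⟨m, hm⟩ : ∃ m : ℤ, m = s.num := ⟨_, rfl⟩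
  have hn' : (n:ℚ) ≠ 0 := by rw [hn]; exact_mod_cast hd
  have hx' : (m:ℚ) = s * n := by rw [hn, hm]; exact_mod_cast hx
  rw [← hm, ← hn] at hc
  clear hx hd hn hm
  have hs : s = m / n := by rw [hx']; field_simp
  have hmn1 : m ≠ n := by rintro rfl; apply h1; rw [hs]; field_simp
  have hmn2 : m ≠ -n := by rintro rfl; apply h2; rw [hs]; push_cast; field_simp
  have hm0 : m ≠ 0 := by rintro rfl; apply h0; rw [hs]; simp
  have hn0 : n ≠ 0 := by exact_mod_cast hn'
  obtain ⟨z, hz⟩ := int_of_rat_sq (w*n^4) ((m^4+4*m^3*n+2*m^2*n^2+n^4)*(m^4+2*m^2*n^2-4*m*n^3+n^4)) (by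
    push_cast; rw [mul_pow, ← h, hx']; ring)
  by_cases hodd : m % 2 = 1 ∧ n % 2 = 1
  · obtain ⟨om, on⟩ := hodd
    have : m % 4 = n % 4 ∨ m % 4 = (-n) % 4 := by omega
    rcases this with h4 | h4
    · obtain ⟨d, rfl⟩ : ∃ d, m = n + 4*d := ⟨(m-n)/4, by omega⟩
      apply odd_case d n z on (by rintro rfl; simp at hmn1) _ hz.symm
      have h5 : IsCoprime (4*d) n := by
        have := (IsCoprime.add_mul_left_left_iff (x := 4*d) (y := n) (z := 1)).1 (by
          simpa [add_comm] using hc)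
        exact this
      exact (IsCoprime.of_mul_left_right h5).symm
    · obtain ⟨d, rfl⟩ : ∃ d, n = -m + 4*d := ⟨(m+n)/4, by omega⟩
      apply odd_case d (-m) z (by omega) (by rintro rfl; simp at hmn2) _ (by rw [hz]; ring)
      have h5 : IsCoprime m (4*d) := by
        have := (IsCoprime.add_mul_left_right_iff (x := m) (y := 4*d) (z := -1)).1 (by
          simpa [add_comm] using hc)
        exact this
      exact (IsCoprime.of_mul_right_right h5).neg_left
  · have ho : (m + n) % 2 = 1 := by
      have : ¬ (m % 2 = 0 ∧ n % 2 = 0) := by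
        rintro ⟨a, b⟩
        have := hc.isUnit_of_dvd' (Int.dvd_of_emod_eq_zero a) (Int.dvd_of_emod_eq_zero b)
        rw [Int.isUnit_iff] at this; omega
      omega
    obtain ⟨k, hk⟩ : ∃ k, m = 2*k+1-n := ⟨(m+n)/2, by omega⟩
    have o1 : (m^2+n^2) % 2 = 1 := by
      rw [hk, show (2*k+1-n)^2+n^2 = 2*(2*k^2+2*k-2*k*n-n+n^2)+1 by ring]; omega
    have cN2 := odd_cop_pow_two _ o1
    have cNm : IsCoprime (m^2+n^2) m := by
      rw [show m^2+n^2 = n^2 + m * m by ring]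
      exact IsCoprime.add_mul_right_left_iff.2 hc.symm.pow_left
    have cNn : IsCoprime (m^2+n^2) n := by
      rw [show m^2+n^2 = m^2 + n * n by ring]
      exact IsCoprime.add_mul_right_left_iff.2 hc.pow_left
    obtain ⟨G, hG⟩ : ∃ G, G = m^4+4*m^3*n+2*m^2*n^2+n^4 := ⟨_, rfl⟩
    have cGN : IsCoprime G (m^2+n^2) := by
      rw [hG, show m^4+4*m^3*n+2*m^2*n^2+n^4 = 2^2*m^3*n + (m^2+n^2)*(m^2+n^2) by ring]
      exact IsCoprime.add_mul_right_left_iff.2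
        (((cN2.symm.pow_left).mul_left cNm.symm.pow_left).mul_left cNn.symm)
    have cGm : IsCoprime G m := by
      rw [hG, show m^4+4*m^3*n+2*m^2*n^2+n^4 = n^4 + (m^3+4*m^2*n+2*m*n^2)*m by ring]
      exact IsCoprime.add_mul_right_left_iff.2 hc.symm.pow_left
    have cGn : IsCoprime G n := by
      rw [hG, show m^4+4*m^3*n+2*m^2*n^2+n^4 = m^4 + (4*m^3+2*m^2*n+n^3)*n by ring]
      exact IsCoprime.add_mul_right_left_iff.2 hc.pow_left
    have cG2 : IsCoprime G 2 := by
      rw [hG, show m^4+4*m^3*n+2*m^2*n^2+n^4 = (m^2+n^2)^2 + (2*m^3*n)*2 by ring]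
      exact IsCoprime.add_mul_right_left_iff.2 cN2.pow_left
    have cGG : IsCoprime G (m^4+2*m^2*n^2-4*m*n^3+n^4) := by
      rw [show m^4+2*m^2*n^2-4*m*n^3+n^4 = -(2^2*m*n*(m^2+n^2)) + G * 1 by rw [hG]; ring]
      exact IsCoprime.add_mul_left_right_iff.2
        ((((cG2.pow_right).mul_right cGm).mul_right cGn).mul_right cGN).neg_right
    rw [← hG] at hz
    have key : ∃ r, G = r^2 := by
      obtain ⟨r, hr | hr⟩ := Int.sq_of_isCoprime cGG hz.symm
      · exact ⟨r, hr⟩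
      · obtain ⟨r', hr' | hr'⟩ := Int.sq_of_isCoprime cGG.symm (by rw [mul_comm]; exact hz.symm)
        · have : G * (r'^2) = z^2 := by rw [← hr', hz]
          have h5 := sq_nonneg r
          have h6 := sq_nonneg z
          rw [hr] at this
          have h7 : r^2 * r'^2 = 0 := by nlinarith [mul_nonneg h5 (sq_nonneg r')]
          rcases mul_eq_zero.1 h7 with h | h
          · exact ⟨0, by rw [hr, h]; norm_num⟩
          · exfalso
            rw [h] at hr'
            have e : m^4+2*m^2*n^2-4*m*n^3+n^4 = (m^2+n^2)^2 - 4*m*n^3 := by ring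
            rw [e] at hr'
            obtain ⟨j, hj⟩ : ∃ j, m^2+n^2 = 2*j+1 := ⟨(m^2+n^2)/2, by omega⟩
            rw [hj] at hr'
            have : 2*(2*j^2+2*j-2*m*n^3)+1 = 0 := by linarith
            omega
        · exfalso
          rcases lt_trichotomy (m*n) 0 with hs | hs | hs
          · have : 0 < n^2 := by positivity
            nlinarith [mul_pos (neg_pos.2 hs) this, sq_nonneg (m^2+n^2), sq_nonneg r']
          · rcases mul_eq_zero.1 hs with h | h
            · exact hm0 h
            · exact hn0 h
          · have : 0 < m^2 := by positivity
            nlinarith [mul_pos hs this, sq_nonneg (m^2+n^2), sq_nonneg r]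
    obtain ⟨r, hr⟩ := key
    apply g1_sq_false s (r/n^2) h0 h2
    have hr' : (m:ℚ)^4+4*m^3*n+2*m^2*n^2+n^4 = r^2 := by rw [hG] at hr; exact_mod_cast hr
    rw [div_pow, ← hr', hx']
    field_simp
end ratcase

end partDEF

section quad
set_option linter.unusedSectionVars false
variable {K : Type*} [Field K] [CharZero K] [Algebra ℚ K]

lemma quad_coord (hK : Module.finrank ℚ K = 2) (x : K) (hx : ∀ q : ℚ, x ≠ q) (y : K) :
    ∃ α β : ℚ, y = α + β * x := by
  have hli : LinearIndependent ℚ ![(1:K), x] := by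
    rw [LinearIndependent.pair_iff]
    intro p q h
    have h' : (p:K) + q * x = 0 := by
      rw [Algebra.smul_def, Algebra.smul_def] at h; simpa using h
    have hq : q = 0 := by
      by_contra hq
      have hq' : (q:K) ≠ 0 := by exact_mod_cast hq
      apply hx (-p/q)
      push_cast; field_simp; linear_combination h'
    subst hq
    refine ⟨?_, rfl⟩
    simpa using h'
  have : FiniteDimensional ℚ K := Module.finite_of_finrank_pos (by omega)
  have hsp := hli.span_eq_top_of_card_eq_finrank' (by simp [hK])
  have hy : y ∈ Submodule.span ℚ (Set.range ![(1:K), x]) := by rw [hsp]; trivial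
  simp only [Matrix.range_cons, Matrix.range_empty, Set.union_empty, Set.singleton_union] at hy
  obtain ⟨p, q, h⟩ := Submodule.mem_span_pair.1 hy
  refine ⟨p, q, ?_⟩
  rw [← h, Algebra.smul_def, Algebra.smul_def]; simp

lemma quad_indep (x : K) (hx : ∀ q : ℚ, x ≠ q) (p q : ℚ) (h : (p:K) + q * x = 0) : p = 0 ∧ q = 0 := by
  have hq : q = 0 := by
    by_contra hq
    have hq' : (q:K) ≠ 0 := by exact_mod_cast hq
    apply hx (-p/q)
    push_cast; field_simp; linear_combination h
  subst hq
  refine ⟨?_, rfl⟩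
  simpa using h

lemma line_types (hK : Module.finrank ℚ K = 2) (x y : K) (hx : ∀ q : ℚ, x ≠ q)
    (h : y^2 = 2*(x^3+x^2-x+1)) : ∃ m : ℚ, 2*x^2+((4-m^2:ℚ):K)*x+((m^2-4*m+2:ℚ):K) = 0 ∨
      2*x^2+((-m^2:ℚ):K)*x+((-(m^2+4*m+2):ℚ):K) = 0 := by
  obtain ⟨v, t, ht⟩ := quad_coord hK x hx (x^2)
  obtain ⟨α, β, hy⟩ := quad_coord hK x hx y
  have hR := quad_indep x hx (2*t*v+(2-β^2)*v+2-α^2) (2*(t^2+v)+(2-β^2)*t-2-2*α*β) (by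
    push_cast
    rw [hy] at h
    linear_combination -h - (2*x + 2*t + 2 - β^2) * ht)
  obtain ⟨h0, h1⟩ := hR
  obtain ⟨r, hr⟩ : ∃ r : ℚ, r = -(2-β^2+2*t)/2 := ⟨_, rfl⟩
  have hP : (α+β*r)^2 = 2*(r^3+r^2-r+1) := by
    rw [hr]; linear_combination -(β^2/2 - t - 1) * h1 - h0
  have hx1 : x - 1 ≠ 0 := by intro h; apply hx 1; push_cast; linear_combination h
  have hx2 : x + 1 ≠ 0 := by intro h; apply hx (-1); push_cast; linear_combination h
  rcases E1f r _ hP with h2 | h2 <;> rw [h2] at hP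
  · have : (α+β-2)*(α+β+2) = 0 := by linear_combination hP
    rcases mul_eq_zero.1 this with h3 | h3
    · refine ⟨β, Or.inl ?_⟩
      have hα : α = 2 - β := by linarith
      rw [hy, hα] at h
      apply mul_left_cancel₀ hx1
      push_cast at h ⊢; linear_combination -h
    · refine ⟨-β, Or.inl ?_⟩
      have hα : α = -2 - β := by linarith
      rw [hy, hα] at h
      apply mul_left_cancel₀ hx1
      push_cast at h ⊢; linear_combination -h
  · have : (α-β-2)*(α-β+2) = 0 := by linear_combination hP
    rcases mul_eq_zero.1 this with h3 | h3
    · refine ⟨β, Or.inr ?_⟩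
      have hα : α = 2 + β := by linarith
      rw [hy, hα] at h
      apply mul_left_cancel₀ hx2
      push_cast at h ⊢; linear_combination -h
    · refine ⟨-β, Or.inr ?_⟩
      have hα : α = -2 + β := by linarith
      rw [hy, hα] at h
      apply mul_left_cancel₀ hx2
      push_cast at h ⊢; linear_combination -h

lemma compare_quad (x x' : K) (hx : ∀ q : ℚ, x ≠ q) (hxx : x * x' = -1) (T N T' N' : ℚ)
    (h : 2*x^2+(T:K)*x+(N:K) = 0) (h' : 2*x'^2+(T':K)*x'+(N':K) = 0) : N * N' = 4 ∧ T * N' = -2*T' := by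
  have e : (N':K)*x^2 - T' * x + 2 = 0 := by
    linear_combination x^2 * h' - (2 * (x * x') - 2 + T' * x) * hxx
  have := quad_indep x hx (4 - N * N') (-2*T' - T * N') (by
    push_cast; linear_combination 2 * e - (N':K) * h)
  exact ⟨by linarith [this.1], by linarith [this.2]⟩

lemma rat_sq_int_false (x : ℚ) (k : ℤ) (h : x^2 = k) (hk : ¬ ∃ w ∈ Finset.Icc (-5:ℤ) 5, w^2 = k) (hk2 : k < 25) : False := by
  obtain ⟨w, hw⟩ := int_of_rat_sq x k h
  apply hk
  refine ⟨w, ?_, hw⟩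
  rw [Finset.mem_Icc]
  constructor <;> nlinarith

lemma mixed (x x' : K) (hx : ∀ q : ℚ, x ≠ q) (hxx : x * x' = -1) (m n : ℚ)
    (h : 2*x^2+((4-m^2:ℚ):K)*x+((m^2-4*m+2:ℚ):K) = 0)
    (h' : 2*x'^2+((-n^2:ℚ):K)*x'+((-(n^2+4*n+2):ℚ):K) = 0) : False := by
  obtain ⟨h1, h2⟩ := compare_quad x x' hx hxx _ _ _ _ h h'
  have k1 : n * (m^2-4*m+2) = 2*(m-2) := by
    have a1 : n^2 * (m^2-4*m+2) = 2*(4-m^2) := by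
      linear_combination (-(m^2-4*m+2)/2) * h2 + ((4-m^2)/2) * h1
    linear_combination -(1/4) * h1 - (1/4) * a1
  have k2 : (m-2)*(m*((m-1)^2-5)) = 0 := by
    have a1 : n^2 * (m^2-4*m+2) = 2*(4-m^2) := by
      linear_combination (-(m^2-4*m+2)/2) * h2 + ((4-m^2)/2) * h1
    linear_combination (1/2)*((m^2-4*m+2) * a1 - (n*(m^2-4*m+2) + 2*(m-2)) * k1)
  have hx1 : x - 1 ≠ 0 := by intro h; apply hx 1; push_cast; linear_combination h
  have hx2 : x + 1 ≠ 0 := by intro h; apply hx (-1); push_cast; linear_combination h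
  rcases mul_eq_zero.1 k2 with k | k
  · have : m = 2 := by linarith
    subst this
    apply mul_ne_zero hx1 hx2
    norm_num at h; linear_combination (1/2) * h
  · rcases mul_eq_zero.1 k with k | k
    · subst k
      apply mul_ne_zero hx2 hx2
      norm_num at h; linear_combination (1/2) * h
    · exact rat_sq_int_false (m-1) 5 (by push_cast; linarith) (by decide) (by norm_num)

lemma irr_case (hK : Module.finrank ℚ K = 2) (x x' y y' : K) (hx : ∀ q : ℚ, x ≠ q) (hxx : x * x' = -1)
    (h : y^2 = 2*(x^3+x^2-x+1)) (h' : y'^2 = 2*(x'^3+x'^2-x'+1)) : x^2 - 8*x - 1 = 0 := by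
  have hx' : ∀ q : ℚ, x' ≠ q := by
    intro q hq
    have hq0 : (q:K) ≠ 0 := by intro h0; rw [hq, h0] at hxx; simp at hxx
    apply hx (-1/q); rw [hq] at hxx; push_cast; field_simp; linear_combination hxx
  have hx1 : x - 1 ≠ 0 := by intro h; apply hx 1; push_cast; linear_combination h
  have hx2 : x + 1 ≠ 0 := by intro h; apply hx (-1); push_cast; linear_combination h
  obtain ⟨m, hm⟩ := line_types hK x y hx h
  obtain ⟨n, hn⟩ := line_types hK x' y' hx' h'
  rcases hm with hm | hm <;> rcases hn with hn | hn
  · exfalso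
    obtain ⟨h1, h2⟩ := compare_quad x x' hx hxx _ _ _ _ hm hn
    have a1 : (n^2-4) * (m^2-4*m+2) = 2*(4-m^2) := by
      linear_combination (-(m^2-4*m+2)/2) * h2 + ((4-m^2)/2) * h1
    have k1 : (n-1) * (m^2-4*m+2) = 2*(1-m) := by
      linear_combination (1/4) * a1 - (1/4) * h1
    have k2 : (m-2)^2*((m-4)^2-12) = 0 := by
      linear_combination -(m^2-4*m+2) * h1 + ((n-1)*(m^2-4*m+2) + 2*(1-m) - 2*(m^2-4*m+2)) * k1
    rcases mul_eq_zero.1 k2 with k | k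
    · have : m = 2 := by have := pow_eq_zero_iff (two_ne_zero) |>.1 k; linarith
      subst this
      apply mul_ne_zero hx1 hx2
      norm_num at hm; linear_combination (1/2) * hm
    · exact rat_sq_int_false (m-4) 12 (by push_cast; linarith) (by decide) (by norm_num)
  · exact (mixed x x' hx hxx m n hm hn).elim
  · exact (mixed x' x hx' (by rw [mul_comm]; exact hxx) n m hn hm).elim
  · obtain ⟨h1, h2⟩ := compare_quad x x' hx hxx _ _ _ _ hm hn
    have a1 : n^2 * (m^2+4*m+2) = 2*m^2 := by
      linear_combination (-(m^2+4*m+2)/2) * h2 + (m^2/2) * h1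
    have k1 : n * (m^2+4*m+2) = -m^2-2*m := by
      linear_combination (1/4) * h1 - (1/4) * a1
    have k2 : m^2*(m*(m+4)) = 0 := by
      linear_combination -(m^2+4*m+2) * a1 + (n*(m^2+4*m+2) -m^2-2*m) * k1
    have : m = 0 ∨ m = -4 := by
      rcases mul_eq_zero.1 k2 with k | k
      · left; exact pow_eq_zero_iff (two_ne_zero) |>.1 k
      · rcases mul_eq_zero.1 k with k | k
        · left; exact k
        · right; linarith
    rcases this with rfl | rfl
    · exfalso
      apply mul_ne_zero hx1 hx2
      norm_num at hm; linear_combination (1/2) * hm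
    · norm_num at hm; linear_combination (1/2) * hm

lemma field_main (hK : Module.finrank ℚ K = 2) (s a b : K) (h0 : s ≠ 0) (h1 : s ≠ 1) (h2 : s ≠ -1)
    (ha : 4*s^2*a^2 = s^4+4*s^3+2*s^2+1) (hb : 4*s^2*b^2 = s^4+2*s^2-4*s+1) :
    (∀ q : ℚ, s ≠ q) ∧ 2*s^2 - s - 2 = 0 := by
  have hp : 1 + s ≠ 0 := by intro h; apply h2; linear_combination h
  have hm : 1 - s ≠ 0 := by intro h; apply h1; linear_combination -h
  have irr : ∀ q : ℚ, s ≠ q := by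
    rintro s rfl
    have h0' : s ≠ 0 := by rintro rfl; simp at h0
    have h1' : s ≠ 1 := by rintro rfl; simp at h1
    have h2' : s ≠ -1 := by rintro rfl; simp at h2
    have ratA : ∀ q : ℚ, a ≠ q := by
      rintro a rfl
      have : 4*s^2*a^2 = s^4+4*s^3+2*s^2+1 := by exact_mod_cast ha
      exact g1_sq_false s (2*s*a) h0' h2' (by rw [← this]; ring)
    have ratB : ∀ q : ℚ, b ≠ q := by
      rintro b rfl
      have : 4*s^2*b^2 = s^4+2*s^2-4*s+1 := by exact_mod_cast hb
      refine g1_sq_false (-1/s) (2*b/s) (by simpa using h0') ?_ ?_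
      · intro h; field_simp at h; apply h1'; linarith
      · field_simp; linear_combination this
    obtain ⟨α, β, hab⟩ := quad_coord hK a ratA b
    obtain ⟨r, hr⟩ : ∃ r : ℚ, r = (s^4+4*s^3+2*s^2+1)/(4*s^2) := ⟨_, rfl⟩
    have hr' : 4*s^2*r = s^4+4*s^3+2*s^2+1 := by rw [hr]; field_simp
    have hrK : 4*(s:K)^2*r = s^4+4*s^3+2*s^2+1 := by exact_mod_cast congrArg (Rat.cast : ℚ → K) hr'
    have har : a^2 = r := by
      apply mul_left_cancel₀ (show (4*(s:K)^2) ≠ 0 from mul_ne_zero (by norm_num) (pow_ne_zero 2 h0))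
      rw [ha, hrK]
    have := quad_indep a ratA (4*s^2*(α^2+β^2*r) - (s^4+2*s^2-4*s+1)) (4*s^2*(2*α*β)) (by
      push_cast; rw [hab] at hb; linear_combination hb - 4*(s:K)^2*β^2*har)
    obtain ⟨e1, e2⟩ := this
    have : α = 0 ∨ β = 0 := by
      have : (4*s^2*2)*(α*β) = 0 := by linarith
      rcases mul_eq_zero.1 this with h | h
      · exfalso; apply h0'; nlinarith
      · exact mul_eq_zero.1 h
    rcases this with rfl | rfl
    · refine rat_prod s (4*s^2*r*β) h0' h1' h2' ?_
      rw [← hr']; linear_combination -(4*s^2*r)*e1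
    · apply ratB α; rw [hab]; simp
  refine ⟨irr, ?_⟩
  have hx : ∀ q : ℚ, (1-s)/(1+s) ≠ q := by
    intro q hq
    rw [div_eq_iff hp] at hq
    by_cases hq1 : q = -1
    · rw [hq1] at hq; push_cast at hq
      have : (2:K) = 0 := by linear_combination hq
      norm_num at this
    · have hq2 : (1+q:K) ≠ 0 := by
        intro h; apply hq1
        have : ((1+q:ℚ):K) = 0 := by push_cast; exact h
        have : 1 + q = 0 := by exact_mod_cast this
        linarith
      apply irr ((1-q)/(1+q))
      push_cast; rw [eq_div_iff hq2]; linear_combination -hq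
  have key := irr_case hK ((1-s)/(1+s)) (-(1+s)/(1-s)) (4*s*a/(1+s)^2) (4*s*b/(1-s)^2) hx
    (by field_simp) (by field_simp; linear_combination (4:K)*ha) (by field_simp; linear_combination (4:K)*hb)
  field_simp at key
  linear_combination (1/4:K) * key
end quad

/-- If `K` is a quadratic field, `c ∈ K`, and `f_c` has `K`-rational points `a, b` of type `2₃`
with `f_c²(a) = f_c²(b)` and `f_c(a) ≠ f_c(b)` (as when `G(f_c, K)` contains a graph of type
14(2,1,1)), then `c = -21/16` and `K = ℚ(√17)`. -/
theorem graph_14_2_1_1_classification (K : IntermediateField ℚ ℂ)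
    (hK : Module.finrank ℚ K = 2) (c a b : K)
    (ha : IsTypeMN c 2 3 a) (hb : IsTypeMN c 2 3 b)
    (heq : (fc c)^[2] a = (fc c)^[2] b) (hne : fc c a ≠ fc c b) :
    c = -21 / 16 ∧ ∃ z : ℂ, z ^ 2 = 17 ∧ K = ℚ⟮z⟯ := by
  obtain ⟨⟨hp1, hp2⟩, hnp⟩ := ha
  have hp2' := hp2 1 le_rfl (by norm_num)
  simp only [Function.iterate_succ, Function.iterate_zero, Function.comp, id,
    show 3 - 1 = 2 from rfl] at hp1 hp2' hnp heq
  set u := fc c a with hu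
  set w := fc c u with hw
  set P := fc c w with hP
  set q := fc c P with hq
  have hv : fc c b = -u := by
    have h1 : u^2 + c = (fc c b)^2 + c := heq
    have h2 : (u - fc c b) * (u + fc c b) = 0 := by linear_combination h1
    rcases mul_eq_zero.1 h2 with h | h
    · exact absurd (sub_eq_zero.1 h) hne
    · linear_combination h
  have hqper : IsPeriodicPt c q := by
    refine ⟨2, by norm_num, ?_⟩
    simp only [Function.iterate_succ, Function.iterate_zero, Function.comp, id]
    rw [hp1]
  have hwq : w = -q := by
    have h1 : w^2 + c = q^2 + c := by
      have : fc c w = fc c q := hp1.symm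
      exact this
    have h2 : (w - q) * (w + q) = 0 := by linear_combination h1
    rcases mul_eq_zero.1 h2 with h | h
    · exfalso; apply hnp; rw [sub_eq_zero.1 h]; exact hqper
    · linear_combination h
  have e1 : P = q^2 + c := hp1.symm
  have e2 : q = P^2 + c := rfl
  have hsum : P + q = -1 := by
    have h2 : (q - P) * (P + q + 1) = 0 := by linear_combination e2 - e1
    rcases mul_eq_zero.1 h2 with h | h
    · exact absurd (sub_eq_zero.1 h) hp2'
    · linear_combination h
  have hc : c = -1 - q - q^2 := by linear_combination -e1 + hsum
  have hu2 : u^2 = 1 + q^2 := by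
    have : w = u^2 + c := rfl
    linear_combination -this + hwq - hc
  have ha2 : a^2 = u - c := by
    have : u = a^2 + c := rfl
    linear_combination -this
  have hb2 : b^2 = -u - c := by
    have : fc c b = b^2 + c := rfl
    linear_combination -this + hv
  have hq0 : q ≠ 0 := by
    intro h; apply hnp
    rw [show w = q by rw [hwq, h]; ring]; exact hqper
  obtain ⟨s, hs⟩ : ∃ s, s = u + q := ⟨_, rfl⟩
  have hs1 : s * (u - q) = 1 := by rw [hs]; linear_combination hu2
  have hs0 : s ≠ 0 := left_ne_zero_of_mul (by rw [hs1]; exact one_ne_zero)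
  have f1 : 2*q*s = s^2 - 1 := by linear_combination -s * hs - hs1
  have f2 : 2*u*s = s^2 + 1 := by linear_combination -s * hs + hs1
  have hsq : s^2 ≠ 1 := by
    intro h
    rw [h] at f1
    have : q * s = 0 := by linear_combination (1/2) * f1
    exact mul_ne_zero hq0 hs0 this
  obtain ⟨irr, hfin⟩ := field_main hK s a b hs0 (by rintro h; apply hsq; rw [h]; norm_num)
    (by rintro h; apply hsq; rw [h]; norm_num)
    (by rw [ha2, hc]; linear_combination 2*s*f2 + (2*s + 2*q*s + s^2 - 1)*f1)
    (by rw [hb2, hc]; linear_combination -2*s*f2 + (2*s + 2*q*s + s^2 - 1)*f1)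
  have hq4 : q = 1/4 := by
    apply mul_right_cancel₀ hs0
    linear_combination (1/2) * f1 + (1/4) * hfin
  refine ⟨by rw [hc, hq4]; norm_num, ((4*s-1 : K) : ℂ), ?_, ?_⟩
  · have : (4*s-1)^2 = (17:K) := by linear_combination 8 * hfin
    have h2 : (((4*s-1)^2 : K) : ℂ) = ((17 : K) : ℂ) := by rw [this]
    exact h2
  · symm
    have hle : ℚ⟮((4*s-1 : K) : ℂ)⟯ ≤ K := by
      rw [IntermediateField.adjoin_simple_le_iff]; exact (4*s-1 : K).2
    have hfd : FiniteDimensional ℚ K := Module.finite_of_finrank_pos (by omega)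
    apply IntermediateField.eq_of_le_of_finrank_le hle
    rw [hK]
    by_contra! hlt
    have h1 : Module.finrank ℚ ℚ⟮((4*s-1 : K) : ℂ)⟯ = 1 := by
      have : FiniteDimensional ℚ ℚ⟮((4*s-1 : K) : ℂ)⟯ :=
        Module.Finite.of_injective (IntermediateField.inclusion hle).toLinearMap
          (IntermediateField.inclusion hle).injective
      have := Module.finrank_pos (R := ℚ) (M := ℚ⟮((4*s-1 : K) : ℂ)⟯)
      omega
    rw [IntermediateField.finrank_adjoin_simple_eq_one_iff, IntermediateField.mem_bot] at h1
    obtain ⟨r, hr⟩ := h1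
    apply irr ((r+1)/4)
    have h3 : algebraMap ℚ K r = 4 * s - 1 := by
      apply Subtype.ext
      rw [← hr]; rfl
    rw [eq_ratCast] at h3
    push_cast
    linear_combination (-1/4) * h3
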